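/- arXiv:1308.4199 — 5 statements merged into one kernel-verified Lean document; each statement's English description precedes it below -/
import Mathlib

section
/- Let b ∈ (0,1) and let f be a C² diffeomorphism of ℝ² such that |det D_x f| ≤ b for all x ∈ ℝ², f has no hyperbolic attracting periodic point, and every point x of the nonwandering set Ω of f satisfies the following dichotomy, where w_n(y) := D_{f y} f^{n-1}(1,0) for n ≥ 1: either (a) there exists ν̄ ∈ ℕ such that ‖w_n(f^{ν̄} x)‖ ≥ e^{((log 2)/4)(n-1)} for infinitely many n ≥ 1, or (b) there exists a sequence (ν_l)_{l≥0} of nonnegative integers with ν₁ > 0, ν_{l+1} ≥ 2ν_l for every l ≥ 1, and ‖w_{ν_{l+1}}(f^{ν₀+⋯+ν_l} x)‖ ≥ e^{((log 2)/4)(ν_{l+1}-1)} for every l ≥ 0. Then every ergodic f-invariant Borel probability measure μ on ℝ² with compact support has two Lyapunov exponents χˢ(μ) < χᵘ(μ), and these satisfy χˢ(μ) < (1/3) log b < 0 and χᵘ(μ) ≥ (1/4) log 2; in particular every such μ is a hyperbolic measure. -/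
open MeasureTheory Filter

noncomputable section

/-- The plane. -/
abbrev P2 := ℝ × ℝ

/-- The derivative `D_x f^n` for `n ∈ ℤ`, where `g` is the inverse of `f`. -/
def DiterZ (f g : P2 → P2) (x : P2) (n : ℤ) : P2 →L[ℝ] P2 :=
  if 0 ≤ n then fderiv ℝ (f^[n.toNat]) x else fderiv ℝ (g^[(-n).toNat]) x

/-- The nonwandering set of `f`: points `z` such that every open neighborhood
`U` of `z` satisfies `f^[n] U ∩ U ≠ ∅` for some `n ≥ 1`. -/
def nonwanderingSet (f : P2 → P2) : Set P2 :=
  {z | ∀ U : Set P2, IsOpen U → z ∈ U →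
    ∃ n : ℕ, 1 ≤ n ∧ (f^[n] '' U ∩ U).Nonempty}

/-- `w_n(y) = D_{f y} f^{n-1} (1,0)`. -/
def wvec (f : P2 → P2) (y : P2) (n : ℕ) : P2 :=
  fderiv ℝ (f^[n - 1]) (f y) (1, 0)

/-- `μ` has two Lyapunov exponents `χs < χu`: μ-a.e. there are invariant
one-dimensional directions (spanned by `es x`, `eu x`) forming a splitting of
the plane, along which the derivatives grow at the exponential rates `χs`
resp. `χu` as `n → ±∞`. -/
def HasTwoLyapunovExponents (f g : P2 → P2) (μ : Measure P2) (χs χu : ℝ) : Prop :=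
  χs < χu ∧
  ∃ es eu : P2 → P2, ∀ᵐ x ∂μ,
    LinearIndependent ℝ ![es x, eu x] ∧
    (∃ c : ℝ, fderiv ℝ f x (es x) = c • es (f x)) ∧
    (∃ c : ℝ, fderiv ℝ f x (eu x) = c • eu (f x)) ∧
    Tendsto (fun n : ℤ => ((n : ℝ))⁻¹ * Real.log ‖DiterZ f g x n (es x)‖)
      atTop (nhds χs) ∧
    Tendsto (fun n : ℤ => ((n : ℝ))⁻¹ * Real.log ‖DiterZ f g x n (es x)‖)
      atBot (nhds χs) ∧
    Tendsto (fun n : ℤ => ((n : ℝ))⁻¹ * Real.log ‖DiterZ f g x n (eu x)‖)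
      atTop (nhds χu) ∧
    Tendsto (fun n : ℤ => ((n : ℝ))⁻¹ * Real.log ‖DiterZ f g x n (eu x)‖)
      atBot (nhds χu)

theorem kc_core {X : Type*} (T : X → X) (g : ℕ → X → ℝ) (C q : ℝ) (N : ℕ) (A : Set X)
    (hC : 0 ≤ C)
    (hsub : ∀ m n x, g (m + n) x ≤ g m x + g n (T^[m] x))
    (hA : ∀ x ∈ A, ∃ l, 1 ≤ l ∧ l ≤ N ∧ g l x ≤ q * l) (n : ℕ) :
    ∀ x, (∀ k n, |g n (T^[k] x)| ≤ C * n) →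
    g n x ≤ q * n + (C + |q|) * (∑ i ∈ Finset.range n, Aᶜ.indicator (fun _ => (1:ℝ)) (T^[i] x))
      + (C + |q|) * N := by
  induction n using Nat.strong_induction_on with
  | _ n ih =>
    intro x hx
    have hD : 0 ≤ C + |q| := by positivity
    have hind : ∀ y, 0 ≤ Aᶜ.indicator (fun _ => (1:ℝ)) y := fun y =>
      Set.indicator_nonneg (fun _ _ => zero_le_one) y
    have hshift : ∀ j, ∀ k n, |g n (T^[k] (T^[j] x))| ≤ C * n := by
      intro j k n
      rw [← Function.iterate_add_apply]; exact hx _ _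
    rcases le_or_gt n N with hnN | hnN
    · have h1 := (abs_le.1 (hx 0 n)).2
      simp only [Function.iterate_zero, id] at h1
      have h2 : 0 ≤ (C + |q|) * (∑ i ∈ Finset.range n,
          Aᶜ.indicator (fun _ => (1:ℝ)) (T^[i] x)) :=
        mul_nonneg hD (Finset.sum_nonneg fun _ _ => hind _)
      have h3 : (n:ℝ) ≤ N := by exact_mod_cast hnN
      have h4 : (C + |q|) * n ≤ (C + |q|) * N := by gcongr
      have h5 : -(|q| * n) ≤ q * n := by
        have := neg_abs_le q
        have := mul_le_mul_of_nonneg_right this (Nat.cast_nonneg (α := ℝ) n)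
        linarith
      nlinarith
    · by_cases hxA : x ∈ A
      · obtain ⟨l, hl1, hlN, hl⟩ := hA x hxA
        obtain ⟨m, rfl⟩ : ∃ m, n = l + m := ⟨n - l, by omega⟩
        have h1 := ih m (by omega) (T^[l] x) (hshift l)
        have h2 := hsub l m x
        rw [Finset.sum_range_add]
        have h3 : 0 ≤ (C + |q|) * (∑ i ∈ Finset.range l,
            Aᶜ.indicator (fun _ => (1:ℝ)) (T^[i] x)) :=
          mul_nonneg hD (Finset.sum_nonneg fun _ _ => hind _)
        have h4 : ∀ i, T^[l + i] x = T^[i] (T^[l] x) := by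
          intro i; rw [add_comm, Function.iterate_add_apply]
        simp only [h4]
        push_cast
        nlinarith
      · obtain ⟨m, rfl⟩ : ∃ m, n = 1 + m := ⟨n - 1, by omega⟩
        have h1 := ih m (by omega) (T^[1] x) (hshift 1)
        have h2 := hsub 1 m x
        rw [Finset.sum_range_add]
        have h4 : ∀ i, T^[1 + i] x = T^[i] (T^[1] x) := by
          intro i; rw [add_comm, Function.iterate_add_apply]
        simp only [h4]
        have h5 := (abs_le.1 (hx 0 1)).2
        have h6 : Aᶜ.indicator (fun _ => (1:ℝ)) x = 1 := by simp [hxA]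
        simp only [Finset.range_one, Finset.sum_singleton, Function.iterate_zero, id, h6] at h5 ⊢
        push_cast at h5 ⊢
        have := neg_abs_le q
        nlinarith

theorem ae_orbit {X : Type*} [MeasurableSpace X] {μ : Measure X} {T : X → X}
    (hT : MeasurePreserving T μ μ) {p : X → Prop} (h : ∀ᵐ x ∂μ, p x) :
    ∀ᵐ x ∂μ, ∀ k : ℕ, p (T^[k] x) := by
  rw [ae_all_iff]
  intro k
  exact (hT.iterate k).quasiMeasurePreserving.ae h

theorem kc_lower {X : Type*} [MeasurableSpace X] (μ : Measure X) [IsProbabilityMeasure μ]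
    (T : X → X) (hT : Ergodic T μ) (g : ℕ → X → ℝ) (hg : ∀ n, Measurable (g n)) (C : ℝ)
    (hC : 0 ≤ C)
    (hsub : ∀ m n x, g (m + n) x ≤ g m x + g n (T^[m] x))
    (hbd : ∀ᵐ x ∂μ, ∀ n, |g n x| ≤ C * n) (χ : ℝ) (hχ : ∀ n : ℕ, n * χ ≤ ∫ x, g n x ∂μ)
    (q : ℝ) (hq : q < χ) : ∀ᵐ x ∂μ, ∀ᶠ n : ℕ in atTop, q * n ≤ g n x := by
  have hbd' := ae_orbit hT.toMeasurePreserving hbd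
  set q0 := (q + χ) / 2 with hq0
  set S : Set X := {x | ∀ k : ℕ, ∀ᶠ n : ℕ in atTop, (q0 - 1 / (k + 1)) * n ≤ g n x} with hS
  have hSm : MeasurableSet S := by
    rw [hS, Set.ofPred_forall]
    refine MeasurableSet.iInter fun k => ?_
    simp only [eventually_atTop, Set.ofPred_exists, Set.ofPred_forall]
    refine MeasurableSet.iUnion fun a => MeasurableSet.iInter fun n => MeasurableSet.iInter fun _ => ?_
    exact measurableSet_le measurable_const (hg n)
  have hinv : S ≤ᵐ[μ] T ⁻¹' S := by
    filter_upwards [hbd'] with x hx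
    intro hxS k
    have hxS : ∀ k : ℕ, ∀ᶠ n : ℕ in atTop, (q0 - 1 / (k + 1)) * n ≤ g n x := hxS
    have h1 := (tendsto_add_atTop_nat 1).eventually (hxS (k + 1))
    have hpos : 0 < (1:ℝ) / (k + 1) - 1 / ((k + 1 : ℕ) + 1) := by
      rw [sub_pos]
      apply one_div_lt_one_div_of_lt
      · positivity
      · push_cast; linarith
    have h2 : ∀ᶠ n : ℕ in atTop, C + |q0 - 1 / ((k + 1 : ℕ) + 1)| ≤
        ((1:ℝ) / (k + 1) - 1 / ((k + 1 : ℕ) + 1)) * n :=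
      (tendsto_natCast_atTop_atTop.const_mul_atTop hpos).eventually_ge_atTop _
    filter_upwards [h1, h2] with n hn1 hn2
    have h3 := hsub 1 n x
    have h5 := (abs_le.1 (hx 0 1)).2
    simp only [Function.iterate_zero, id, Nat.cast_one, mul_one, Function.iterate_one] at h5 h3
    rw [add_comm 1 n] at h3
    have h6 := neg_abs_le (q0 - 1 / ((k + 1 : ℕ) + 1))
    push_cast at *
    nlinarith
  rcases hT.ae_empty_or_univ_of_ae_le_preimage hSm.nullMeasurableSet hinv with h0 | h1
  · exfalso
    -- bad case
    set A : ℕ → Set X := fun N => {x | ∃ l, 1 ≤ l ∧ l ≤ N ∧ g l x ≤ q0 * l} with hA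
    have hAm : ∀ N, MeasurableSet (A N) := by
      intro N
      simp only [hA, Set.ofPred_exists]
      refine MeasurableSet.iUnion fun l => ?_
      have : {x | 1 ≤ l ∧ l ≤ N ∧ g l x ≤ q0 * l} =
        {x | 1 ≤ l ∧ l ≤ N} ∩ {x | g l x ≤ q0 * l} := by ext; simp [and_assoc]
      rw [this]
      exact (MeasurableSet.const _).inter (measurableSet_le (hg l) measurable_const)
    have hAanti : Antitone (fun N => (A N)ᶜ) := by
      intro N M hNM
      apply Set.compl_subset_compl.2
      rintro x ⟨l, h1, h2, h3⟩
      exact ⟨l, h1, h2.trans hNM, h3⟩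
    have hinter : μ (⋂ N, (A N)ᶜ) = 0 := by
      rw [← nonpos_iff_eq_zero, ← measure_empty (μ := μ), ← measure_congr h0]
      apply measure_mono
      intro x hx k
      simp only [Set.mem_iInter, Set.mem_compl_iff, hA, Set.mem_ofPred_eq, not_exists, not_and,
        not_le] at hx
      filter_upwards [eventually_ge_atTop 1] with n hn
      have := hx n n hn le_rfl
      have h2 : (0:ℝ) ≤ 1 / (k + 1) * n := by positivity
      nlinarith
    have hlim : Tendsto (fun N => μ.real (A N)ᶜ) atTop (nhds 0) := by
      have := tendsto_measure_iInter_atTop (μ := μ)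
        (fun N => (hAm N).compl.nullMeasurableSet) hAanti ⟨0, measure_ne_top _ _⟩
      rw [hinter] at this
      have := (ENNReal.tendsto_toReal ENNReal.zero_ne_top).comp this
      simpa [Function.comp_def, Measure.real] using this
    have key : ∀ N, χ ≤ q0 + (C + |q0|) * μ.real (A N)ᶜ := by
      intro N
      have hint : ∀ n : ℕ, n * χ ≤ q0 * n + (C + |q0|) * (n * μ.real (A N)ᶜ) + (C + |q0|) * N := by
        intro n
        refine (hχ n).trans ?_
        have hInt : ∀ i, Integrable (fun x => (A N)ᶜ.indicator (fun _ => (1:ℝ)) (T^[i] x)) μ := by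
          intro i
          have := (integrable_const (μ := μ) (1:ℝ)).indicator (hAm N).compl
          exact (hT.toMeasurePreserving.iterate i).integrable_comp_of_integrable this
        have hval : ∀ i, ∫ x, (A N)ᶜ.indicator (fun _ => (1:ℝ)) (T^[i] x) ∂μ = μ.real (A N)ᶜ := by
          intro i
          have h1 := (hT.toMeasurePreserving.iterate i)
          have h2 : (fun x => (A N)ᶜ.indicator (fun _ => (1:ℝ)) (T^[i] x)) =
            ((T^[i]) ⁻¹' (A N)ᶜ).indicator (fun _ => (1:ℝ)) := by
            rfl
          rw [h2, integral_indicator_const _ (h1.measurable (hAm N).compl),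
            measureReal_def, h1.measure_preimage (hAm N).compl.nullMeasurableSet]
          simp [measureReal_def]
        have hIs : Integrable (fun x => ∑ i ∈ Finset.range n,
          (A N)ᶜ.indicator (fun _ => (1:ℝ)) (T^[i] x)) μ :=
          integrable_finsetSum _ fun i _ => hInt i
        have hIg : Integrable (g n) μ := by
          refine Integrable.of_bound (hg n).aestronglyMeasurable (C * n) ?_
          filter_upwards [hbd] with x hx using hx n
        calc ∫ x, g n x ∂μ ≤ ∫ x, (q0 * n + (C + |q0|) * (∑ i ∈ Finset.range n,
              (A N)ᶜ.indicator (fun _ => (1:ℝ)) (T^[i] x)) + (C + |q0|) * N) ∂μ := by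
              apply integral_mono_ae hIg
              · exact ((integrable_const _).add (hIs.const_mul _)).add (integrable_const _)
              · filter_upwards [hbd'] with x hx
                exact kc_core T g C q0 N (A N) hC hsub (fun x hx => hx) n x hx
          _ = _ := by
              have h7 : Integrable (fun x => q0 * n + (C + |q0|) * (∑ i ∈ Finset.range n,
                (A N)ᶜ.indicator (fun _ => (1:ℝ)) (T^[i] x))) μ :=
                (integrable_const _).add (hIs.const_mul _)
              rw [integral_add h7 (integrable_const _),
                integral_add (integrable_const _) (hIs.const_mul _), integral_const_mul (C + |q0|),
                integral_finsetSum _ (fun i _ => hInt i)]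
              simp [hval]
      by_contra hcon
      push Not at hcon
      have hpos : 0 < χ - (q0 + (C + |q0|) * μ.real (A N)ᶜ) := by linarith
      have := (tendsto_natCast_atTop_atTop.const_mul_atTop hpos).eventually_gt_atTop
        ((C + |q0|) * N)
      obtain ⟨n, hn⟩ := this.exists
      have := hint n
      nlinarith
    have : χ ≤ q0 := by
      have h2 : Tendsto (fun N => q0 + (C + |q0|) * μ.real (A N)ᶜ) atTop (nhds (q0 + (C+|q0|) * 0)) :=
        tendsto_const_nhds.add (hlim.const_mul _)
      simpa using ge_of_tendsto' h2 key
    linarith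
  · have h2 : ∀ᵐ x ∂μ, x ∈ S := eventuallyEq_univ.1 h1
    filter_upwards [h2] with x hx
    have hpos : 0 < q0 - q := by rw [hq0]; linarith
    obtain ⟨k, hk⟩ := exists_nat_one_div_lt hpos
    filter_upwards [hx k] with n hn
    refine le_trans ?_ hn
    gcongr
    linarith

theorem bk_half {X : Type*} [MeasurableSpace X] (μ : Measure X) [IsProbabilityMeasure μ]
    (T : X → X) (hT : Ergodic T μ) (h : X → ℝ) (hh : Measurable h) (C : ℝ)
    (hbd : ∀ᵐ x ∂μ, |h x| ≤ C) :
    ∀ᵐ x ∂μ, ∀ ε > 0, ∀ᶠ n : ℕ in atTop,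
      (∫ y, h y ∂μ - ε) * n ≤ ∑ i ∈ Finset.range n, h (T^[i] x) := by
  have hC : 0 ≤ C := by
    obtain ⟨x, hx⟩ := hbd.exists
    exact (abs_nonneg _).trans hx
  have hbd' := ae_orbit hT.toMeasurePreserving hbd
  have hIh : Integrable h μ := Integrable.of_bound hh.aestronglyMeasurable C hbd
  have main : ∀ k : ℕ, ∀ᵐ x ∂μ, ∀ᶠ n : ℕ in atTop,
      (∫ y, h y ∂μ - 1 / (k + 1)) * n ≤ ∑ i ∈ Finset.range n, h (T^[i] x) := by
    intro k
    refine kc_lower μ T hT (fun n x => ∑ i ∈ Finset.range n, h (T^[i] x)) ?_ C hC ?_ ?_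
      (∫ y, h y ∂μ) ?_ _ ?_
    · intro n
      exact Finset.measurable_fun_sum _ fun i _ => hh.comp (hT.measurable.iterate i)
    · intro m n x
      rw [Finset.sum_range_add]
      apply le_of_eq
      congr 1
      apply Finset.sum_congr rfl
      intro i _
      rw [add_comm, Function.iterate_add_apply]
    · filter_upwards [hbd'] with x hx n
      refine (Finset.abs_sum_le_sum_abs _ _).trans ?_
      refine (Finset.sum_le_sum fun i _ => hx i).trans ?_
      simp [mul_comm]
    · intro n
      rw [integral_finsetSum]
      · have : ∀ i, ∫ x, h (T^[i] x) ∂μ = ∫ x, h x ∂μ := by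
          intro i
          have h1 := hT.toMeasurePreserving.iterate i
          have h2 := integral_map (μ := μ) h1.aemeasurable (f := h)
            (by rw [h1.map_eq]; exact hh.aestronglyMeasurable)
          rw [h1.map_eq] at h2
          exact h2.symm
        simp [this]
      · intro i _
        exact (hT.toMeasurePreserving.iterate i).integrable_comp_of_integrable hIh
    · have : (0:ℝ) < 1 / (k + 1) := by positivity
      linarith
  filter_upwards [ae_all_iff.2 main] with x hx ε hε
  obtain ⟨k, hk⟩ := exists_nat_one_div_lt hε
  filter_upwards [hx k] with n hn
  refine le_trans ?_ hn
  gcongr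

theorem bk_full {X : Type*} [MeasurableSpace X] (μ : Measure X) [IsProbabilityMeasure μ]
    (T : X → X) (hT : Ergodic T μ) (h : X → ℝ) (hh : Measurable h) (C : ℝ)
    (hbd : ∀ᵐ x ∂μ, |h x| ≤ C) :
    ∀ᵐ x ∂μ, ∀ ε > 0, ∃ E, ∀ n : ℕ,
      |∑ i ∈ Finset.range n, h (T^[i] x) - (∫ y, h y ∂μ) * n| ≤ ε * n + E := by
  have h1 := bk_half μ T hT h hh C hbd
  have h2 := bk_half μ T hT (fun x => - h x) hh.neg C (by simpa using hbd)
  filter_upwards [h1, h2] with x hx1 hx2 ε hε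
  obtain ⟨M, hM⟩ := eventually_atTop.1 ((hx1 ε hε).and (hx2 ε hε))
  refine ⟨∑ n ∈ Finset.range M, |∑ i ∈ Finset.range n, h (T^[i] x) - (∫ y, h y ∂μ) * n|, ?_⟩
  intro n
  rcases lt_or_ge n M with hn | hn
  · have := Finset.single_le_sum (f := fun n : ℕ => |∑ i ∈ Finset.range n, h (T^[i] x) - (∫ y, h y ∂μ) * n|)
      (fun i _ => abs_nonneg _) (Finset.mem_range.2 hn)
    have h3 : 0 ≤ ε * n := by positivity
    linarith
  · obtain ⟨ha, hb⟩ := hM n hn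
    rw [integral_neg, Finset.sum_neg_distrib] at hb
    have h3 : 0 ≤ ∑ n ∈ Finset.range M, |∑ i ∈ Finset.range n, h (T^[i] x) - (∫ y, h y ∂μ) * n| :=
      Finset.sum_nonneg fun _ _ => abs_nonneg _
    rw [abs_le]
    constructor <;> nlinarith

theorem bk_tendsto {X : Type*} [MeasurableSpace X] (μ : Measure X) [IsProbabilityMeasure μ]
    (T : X → X) (hT : Ergodic T μ) (h : X → ℝ) (hh : Measurable h) (C : ℝ)
    (hbd : ∀ᵐ x ∂μ, |h x| ≤ C) :
    ∀ᵐ x ∂μ, Tendsto (fun n : ℕ => (n:ℝ)⁻¹ * ∑ i ∈ Finset.range n, h (T^[i] x)) atTop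
      (nhds (∫ y, h y ∂μ)) := by
  filter_upwards [bk_full μ T hT h hh C hbd] with x hx
  rw [Metric.tendsto_atTop']
  intro ε hε
  obtain ⟨E, hE⟩ := hx (ε / 2) (by positivity)
  have h2 : ∀ᶠ n : ℕ in atTop, E < ε / 2 * n :=
    (tendsto_natCast_atTop_atTop.const_mul_atTop (by positivity)).eventually_gt_atTop _
  obtain ⟨M, hM⟩ := eventually_atTop.1 h2
  refine ⟨M, fun n hn => ?_⟩
  have hn0 : (0:ℝ) < n := by
    have : 0 < n := by omega
    exact_mod_cast this
  rw [Real.dist_eq]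
  have : (n:ℝ)⁻¹ * ∑ i ∈ Finset.range n, h (T^[i] x) - ∫ y, h y ∂μ =
    (n:ℝ)⁻¹ * (∑ i ∈ Finset.range n, h (T^[i] x) - (∫ y, h y ∂μ) * n) := by
    field_simp
  rw [this, abs_mul, abs_of_pos (inv_pos.2 hn0), inv_mul_lt_iff₀ hn0]
  have := hE n
  have := hM n hn.le
  linarith

theorem kc_full {X : Type*} [MeasurableSpace X] (μ : Measure X) [IsProbabilityMeasure μ]
    (T : X → X) (hT : Ergodic T μ) (g : ℕ → X → ℝ) (hg : ∀ n, Measurable (g n)) (C : ℝ)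
    (hC : 0 ≤ C)
    (hsub : ∀ m n x, g (m + n) x ≤ g m x + g n (T^[m] x))
    (hbd : ∀ᵐ x ∂μ, ∀ n, |g n x| ≤ C * n)
    (hmono : ∀ᵐ x ∂μ, ∀ n, g n x ≤ g (n + 1) x + C) :
    ∃ χ : ℝ, Tendsto (fun n : ℕ => (∫ x, g n x ∂μ) / n) atTop (nhds χ) ∧
      (∀ᵐ x ∂μ, Tendsto (fun n : ℕ => (n:ℝ)⁻¹ * g n x) atTop (nhds χ)) ∧
      ∀ᵐ x ∂μ, ∀ ε > 0, ∀ D : ℕ, ∀ᶠ n : ℕ in atTop, ∀ S ≤ n + D,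
        g n (T^[S] x) ≤ n * (χ + ε) := by
  have hIg : ∀ n, Integrable (g n) μ := by
    intro n
    refine Integrable.of_bound (hg n).aestronglyMeasurable (C * n) ?_
    filter_upwards [hbd] with x hx using hx n
  have hIT : ∀ m n, ∫ x, g n (T^[m] x) ∂μ = ∫ x, g n x ∂μ := by
    intro i n
    have h1 := hT.toMeasurePreserving.iterate i
    have h2 := integral_map (μ := μ) h1.aemeasurable (f := g n)
      (by rw [h1.map_eq]; exact (hg n).aestronglyMeasurable)
    rw [h1.map_eq] at h2
    exact h2.symm
  have hu : Subadditive (fun n => ∫ x, g n x ∂μ) := by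
    intro m n
    have hi : Integrable (fun x => g n (T^[m] x)) μ :=
      (hT.toMeasurePreserving.iterate m).integrable_comp_of_integrable (hIg n)
    have : ∫ x, g (m + n) x ∂μ ≤ ∫ x, (g m x + g n (T^[m] x)) ∂μ :=
      integral_mono (hIg _) ((hIg m).add hi) (hsub m n)
    rw [integral_add (hIg m) hi, hIT] at this
    exact this
  have habs : ∀ n : ℕ, |∫ x, g n x ∂μ| ≤ C * n := by
    intro n
    have := norm_integral_le_of_norm_le_const (μ := μ) (f := g n) (C := C * n)
      (by filter_upwards [hbd] with x hx using hx n)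
    simpa using this
  have hbdd : BddBelow (Set.range fun n : ℕ => (∫ x, g n x ∂μ) / n) := by
    refine ⟨-C, ?_⟩
    rintro _ ⟨n, rfl⟩
    rcases Nat.eq_zero_or_pos n with rfl | hn
    · simp [hC]
    · have hn0 : (0:ℝ) < n := by exact_mod_cast hn
      simp only
      rw [le_div_iff₀ hn0]
      have := (abs_le.1 (habs n)).1
      linarith
  set χ := hu.lim with hχdef
  have hlim := hu.tendsto_lim hbdd
  have hle : ∀ n : ℕ, n * χ ≤ ∫ x, g n x ∂μ := by
    intro n
    rcases Nat.eq_zero_or_pos n with rfl | hn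
    · have := (abs_le.1 (habs 0)).1
      simpa using this
    · have hn0 : (0:ℝ) < n := by exact_mod_cast hn
      have := hu.lim_le_div hbdd hn.ne'
      rw [le_div_iff₀ hn0] at this
      linarith
  have hlow : ∀ᵐ x ∂μ, ∀ k : ℕ, ∀ᶠ n : ℕ in atTop, (χ - 1 / (k + 1)) * n ≤ g n x := by
    rw [ae_all_iff]
    intro k
    refine kc_lower μ T hT g hg C hC hsub hbd χ hle _ ?_
    have : (0:ℝ) < 1 / (k + 1) := by positivity
    linarith
  have hbk : ∀ᵐ x ∂μ, ∀ N : ℕ, ∀ ε > 0, ∃ E, ∀ n : ℕ,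
      |∑ i ∈ Finset.range n, g N (T^[i] x) - (∫ y, g N y ∂μ) * n| ≤ ε * n + E := by
    rw [ae_all_iff]
    intro N
    refine bk_full μ T hT (g N) (hg N) (C * N) ?_
    filter_upwards [hbd] with x hx using hx N
  have hup : ∀ᵐ x ∂μ, ∀ ε > 0, ∀ D : ℕ, ∀ᶠ n : ℕ in atTop, ∀ S ≤ n + D,
        g n (T^[S] x) ≤ n * (χ + ε) := by
    filter_upwards [hbk, ae_orbit hT.toMeasurePreserving hbd,
      ae_orbit hT.toMeasurePreserving hmono] with x hx hxb hxm ε hε D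
    obtain ⟨N, hN1, hN⟩ : ∃ N : ℕ, 1 ≤ N ∧ (∫ x, g N x ∂μ) / N < χ + ε / 2 := by
      have := (hlim.eventually_lt_const (show χ < χ + ε / 2 by linarith)).and
        (eventually_ge_atTop 1)
      obtain ⟨N, h1, h2⟩ := this.exists
      exact ⟨N, h2, h1⟩
    have hN0 : (0:ℝ) < N := by exact_mod_cast hN1
    rw [div_lt_iff₀ hN0] at hN
    have hη : 0 < N * ε / 12 := by positivity
    obtain ⟨E, hE⟩ := hx N (N * ε / 12) hη
    -- telescoping
    have htel : ∀ S n : ℕ, ∑ j ∈ Finset.range N, g (n + j) (T^[S] x) ≤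
        ∑ j ∈ Finset.range N, g j (T^[S] x) + ∑ i ∈ Finset.range n, g N (T^[S + i] x) := by
      intro S n
      induction n with
      | zero => simp
      | succ n ih =>
        rw [Finset.sum_range_succ]
        have h1 : ∑ j ∈ Finset.range N, g (n + 1 + j) (T^[S] x) + g n (T^[S] x) =
            ∑ j ∈ Finset.range N, g (n + j) (T^[S] x) + g (n + N) (T^[S] x) := by
          rw [← Finset.sum_range_succ (fun j => g (n + j) (T^[S] x)), Finset.sum_range_succ']
          simp only [add_zero]
          congr 1
          apply Finset.sum_congr rfl
          intro j _
          rw [add_assoc, add_comm 1 j]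
        have h2 := hsub n N (T^[S] x)
        rw [← Function.iterate_add_apply, add_comm n S] at h2
        linarith
    have hmon : ∀ S n j : ℕ, g n (T^[S] x) ≤ g (n + j) (T^[S] x) + C * j := by
      intro S n j
      induction j with
      | zero => simp
      | succ j ih =>
        have := hxm S (n + j)
        push_cast
        rw [← add_assoc]
        linarith
    have hsumlow : ∀ S n : ℕ, N * g n (T^[S] x) - N * (C * N) ≤
        ∑ j ∈ Finset.range N, g (n + j) (T^[S] x) := by
      intro S n
      have : ∑ j ∈ Finset.range N, (g n (T^[S] x) - C * N) ≤
          ∑ j ∈ Finset.range N, g (n + j) (T^[S] x) := by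
        apply Finset.sum_le_sum
        intro j hj
        have h1 := hmon S n j
        have h2 : (j:ℝ) ≤ N := by exact_mod_cast (Finset.mem_range.1 hj).le
        have : C * j ≤ C * N := by gcongr
        linarith
      simp only [Finset.sum_const, Finset.card_range, nsmul_eq_mul] at this
      linarith
    have hsum0 : ∀ S : ℕ, ∑ j ∈ Finset.range N, g j (T^[S] x) ≤ N * (C * N) := by
      intro S
      have : ∑ j ∈ Finset.range N, g j (T^[S] x) ≤ ∑ j ∈ Finset.range N, C * N := by
        apply Finset.sum_le_sum
        intro j hj
        have h1 := (abs_le.1 (hxb S j)).2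
        have h2 : (j:ℝ) ≤ N := by exact_mod_cast (Finset.mem_range.1 hj).le
        have : C * j ≤ C * N := by gcongr
        linarith
      simpa only [Finset.sum_const, Finset.card_range, nsmul_eq_mul] using this
    have hev : ∀ᶠ n : ℕ in atTop, 2 * (N * (C * N)) + 2 * E + 2 * (N * ε / 12) * D <
        (N * ε / 4) * n :=
      (tendsto_natCast_atTop_atTop.const_mul_atTop (by positivity)).eventually_gt_atTop _
    filter_upwards [hev] with n hn S hS
    have h1 := htel S n
    have h2 := hsumlow S n
    have h3 := hsum0 S
    have h4 := hE S
    have h5 := hE (S + n)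
    rw [Finset.sum_range_add] at h5
    have h6 := (abs_le.1 h5).2
    have h7 := (abs_le.1 h4).1
    push_cast at h6
    have h8 : (S:ℝ) ≤ n + D := by exact_mod_cast hS
    have h9 : N * ε / 12 * (2 * S + n) ≤ N * ε / 12 * (3 * n + 2 * D) := by
      apply mul_le_mul_of_nonneg_left _ hη.le; linarith
    have h10 : (∫ x, g N x ∂μ) * n ≤ (χ + ε / 2) * N * n := by gcongr
    have h11 : N * g n (T^[S] x) ≤ N * (n * (χ + ε)) := by nlinarith
    exact le_of_mul_le_mul_left h11 hN0
  refine ⟨χ, hlim, ?_, hup⟩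
  filter_upwards [hup, hlow] with x hx1 hx2
  rw [Metric.tendsto_atTop]
  intro ε hε
  obtain ⟨k, hk⟩ := exists_nat_one_div_lt hε
  obtain ⟨M, hM⟩ := eventually_atTop.1 (((hx1 (ε/2) (by positivity) 0).and (hx2 k)).and
    (eventually_ge_atTop 1))
  refine ⟨M, fun n hn => ?_⟩
  obtain ⟨⟨h1, h2⟩, h3⟩ := hM n hn
  have h1 := h1 0 (Nat.zero_le _)
  simp only [Function.iterate_zero, id] at h1
  have hn0 : (0:ℝ) < n := by exact_mod_cast h3
  rw [Real.dist_eq, abs_lt]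
  constructor
  · have : χ - ε < (n:ℝ)⁻¹ * g n x := by
      rw [lt_inv_mul_iff₀ hn0]
      nlinarith
    linarith
  · have : (n:ℝ)⁻¹ * g n x < χ + ε := by
      rw [inv_mul_lt_iff₀ hn0]
      nlinarith
    linarith

def wd (u v : P2) : ℝ := u.1 * v.2 - u.2 * v.1

def dt (A : P2 →L[ℝ] P2) : ℝ := wd (A (1, 0)) (A (0, 1))

theorem clm_apply (A : P2 →L[ℝ] P2) (u : P2) : A u = u.1 • A (1, 0) + u.2 • A (0, 1) := by
  rw [← map_smul, ← map_smul, ← map_add]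
  congr 1
  ext <;> simp

theorem wd_map (A : P2 →L[ℝ] P2) (u v : P2) : wd (A u) (A v) = dt A * wd u v := by
  rw [clm_apply A u, clm_apply A v]
  simp only [dt, wd, Prod.fst_add, Prod.snd_add, Prod.smul_fst, Prod.smul_snd, smul_eq_mul]
  ring

theorem dt_comp (A B : P2 →L[ℝ] P2) : dt (A.comp B) = dt A * dt B := by
  have := wd_map A (B (1, 0)) (B (0, 1))
  simpa [dt] using this

theorem dt_id : dt (ContinuousLinearMap.id ℝ P2) = 1 := by simp [dt, wd]

theorem dt_eq_det (A : P2 →L[ℝ] P2) : LinearMap.det A.toLinearMap = dt A := by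
  rw [← LinearMap.det_toMatrix (Module.Basis.finTwoProd ℝ), Matrix.det_fin_two]
  simp [LinearMap.toMatrix_apply, dt, wd]
  ring

theorem wd_le (u v : P2) : |wd u v| ≤ 2 * ‖u‖ * ‖v‖ := by
  have h1 : |u.1| ≤ ‖u‖ := norm_fst_le u
  have h2 : |u.2| ≤ ‖u‖ := norm_snd_le u
  have h3 : |v.1| ≤ ‖v‖ := norm_fst_le v
  have h4 : |v.2| ≤ ‖v‖ := norm_snd_le v
  have h5 : |u.1 * v.2| ≤ ‖u‖ * ‖v‖ := by rw [abs_mul]; gcongr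
  have h6 : |u.2 * v.1| ≤ ‖u‖ * ‖v‖ := by rw [abs_mul]; gcongr
  have := abs_sub (u.1 * v.2) (u.2 * v.1)
  unfold wd
  linarith

theorem plucker (u v w : P2) : wd u w • v = wd u v • w + wd v w • u := by
  ext <;> simp [wd] <;> ring

theorem wd_swap (u v : P2) : wd u v = - wd v u := by simp [wd]; ring

theorem wd_tri (u v w : P2) (hu : ‖u‖ = 1) (hv : ‖v‖ = 1) (hw : ‖w‖ = 1) :
    |wd u w| ≤ |wd u v| + |wd v w| := by
  have h := congrArg norm (plucker u v w)
  rw [norm_smul, hv, mul_one, Real.norm_eq_abs] at h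
  rw [h]
  refine (norm_add_le _ _).trans ?_
  rw [norm_smul, norm_smul, hu, hw, mul_one, mul_one]
  simp

theorem norm_le_of_unit (A : P2 →L[ℝ] P2) (u v : P2) (hu : ‖u‖ = 1) (hv : ‖v‖ = 1) :
    ‖A v‖ ≤ 2 * ‖A u‖ + |wd u v| * ‖A‖ := by
  set u' : P2 := (-u.2, u.1) with hu'
  have hn : ‖u'‖ = 1 := by
    rw [← hu, hu', Prod.norm_def, Prod.norm_def]
    simp [max_comm]
  have hs : 1 ≤ wd u u' := by
    simp only [wd, hu']
    rw [Prod.norm_def] at hu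
    simp only [Real.norm_eq_abs] at hu
    rcases max_choice |u.1| |u.2| with h | h <;> rw [h] at hu
    · nlinarith [sq_abs u.1, sq_nonneg u.2]
    · nlinarith [sq_abs u.2, sq_nonneg u.1]
  have h := congrArg (fun x => ‖A x‖) (plucker u v u')
  simp only [map_smul, map_add, norm_smul, Real.norm_eq_abs] at h
  have h1 : ‖A v‖ ≤ |wd u u'| * ‖A v‖ := by
    have : 1 ≤ |wd u u'| := hs.trans (le_abs_self _)
    nlinarith [norm_nonneg (A v)]
  have h2 : ‖wd u v • A u' + wd v u' • A u‖ ≤ |wd u v| * ‖A u'‖ + |wd v u'| * ‖A u‖ := by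
    refine (norm_add_le _ _).trans ?_
    simp [norm_smul]
  have h3 : ‖A u'‖ ≤ ‖A‖ := by simpa [hn] using A.le_opNorm u'
  have h4 : |wd v u'| ≤ 2 := by simpa [hn, hv] using wd_le v u'
  have h5 : |wd u v| * ‖A u'‖ ≤ |wd u v| * ‖A‖ := by gcongr
  have h6 : |wd v u'| * ‖A u‖ ≤ 2 * ‖A u‖ := by gcongr
  linarith

theorem opnorm_le_row (A : P2 →L[ℝ] P2) (m : ℝ) (h1 : |(A (1, 0)).1| ≤ m) (h2 : |(A (0, 1)).1| ≤ m)
    (h3 : |(A (1, 0)).2| ≤ m) (h4 : |(A (0, 1)).2| ≤ m) : ‖A‖ ≤ 2 * m := by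
  have hm : 0 ≤ m := (abs_nonneg _).trans h1
  refine A.opNorm_le_bound (by positivity) fun u => ?_
  have g1 : |u.1| ≤ ‖u‖ := norm_fst_le u
  have g2 : |u.2| ≤ ‖u‖ := norm_snd_le u
  have g3 : ‖A (1, 0)‖ ≤ m := by rw [Prod.norm_def]; exact max_le h1 h3
  have g4 : ‖A (0, 1)‖ ≤ m := by rw [Prod.norm_def]; exact max_le h2 h4
  rw [clm_apply A u]
  refine (norm_add_le _ _).trans ?_
  rw [norm_smul, norm_smul, Real.norm_eq_abs, Real.norm_eq_abs]
  have k1 : |u.1| * ‖A (1, 0)‖ ≤ ‖u‖ * m := by gcongr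
  have k2 : |u.2| * ‖A (0, 1)‖ ≤ ‖u‖ * m := by gcongr
  linarith

theorem exists_small_aux (A : P2 →L[ℝ] P2) (z : P2) (hz : ‖A z‖ = |dt A|) (h : ‖A‖ ≤ 2 * ‖z‖) :
    ∃ v : P2, ‖v‖ = 1 ∧ ‖A v‖ * ‖A‖ ≤ 2 * |dt A| := by
  rcases (norm_nonneg z).eq_or_lt with h0 | h0
  · refine ⟨(1, 0), by simp [Prod.norm_def], ?_⟩
    have : ‖A‖ = 0 := le_antisymm (by linarith) (norm_nonneg _)
    rw [this, mul_zero]; positivity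
  · refine ⟨‖z‖⁻¹ • z, ?_, ?_⟩
    · rw [norm_smul, norm_inv, norm_norm, inv_mul_cancel₀ h0.ne']
    · rw [map_smul, norm_smul, norm_inv, norm_norm, hz]
      calc ‖z‖⁻¹ * |dt A| * ‖A‖ ≤ ‖z‖⁻¹ * |dt A| * (2 * ‖z‖) := by gcongr
        _ = 2 * |dt A| := by field_simp

theorem exists_small (A : P2 →L[ℝ] P2) : ∃ v : P2, ‖v‖ = 1 ∧ ‖A v‖ * ‖A‖ ≤ 2 * |dt A| := by
  rcases le_total (max |(A (1, 0)).1| |(A (0, 1)).1|) (max |(A (1, 0)).2| |(A (0, 1)).2|) with h | h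
  · refine exists_small_aux A ((A (0, 1)).2, -(A (1, 0)).2) ?_ ?_
    · rw [clm_apply, Prod.norm_def]
      simp only [Prod.fst_add, Prod.snd_add, Prod.smul_fst, Prod.smul_snd, smul_eq_mul, dt, wd,
        Real.norm_eq_abs]
      have : (A (0, 1)).2 * (A (1, 0)).2 + -(A (1, 0)).2 * (A (0, 1)).2 = 0 := by ring
      rw [this, abs_zero, max_eq_left (abs_nonneg _)]
      congr 1; ring
    · have hn : ‖(((A (0, 1)).2, -(A (1, 0)).2) : P2)‖ = max |(A (1, 0)).2| |(A (0, 1)).2| := by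
        rw [Prod.norm_def]; simp [max_comm]
      rw [hn]
      apply opnorm_le_row
      · exact (le_max_left _ _).trans h
      · exact (le_max_right _ _).trans h
      · exact le_max_left _ _
      · exact le_max_right _ _
  · refine exists_small_aux A (-(A (0, 1)).1, (A (1, 0)).1) ?_ ?_
    · rw [clm_apply, Prod.norm_def]
      simp only [Prod.fst_add, Prod.snd_add, Prod.smul_fst, Prod.smul_snd, smul_eq_mul, dt, wd,
        Real.norm_eq_abs]
      have : -(A (0, 1)).1 * (A (1, 0)).1 + (A (1, 0)).1 * (A (0, 1)).1 = 0 := by ring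
      rw [this, abs_zero, max_eq_right (abs_nonneg _)]
      congr 1; ring
    · have hn : ‖((-(A (0, 1)).1, (A (1, 0)).1) : P2)‖ = max |(A (1, 0)).1| |(A (0, 1)).1| := by
        rw [Prod.norm_def]; simp [max_comm]
      rw [hn]
      apply opnorm_le_row
      · exact le_max_left _ _
      · exact le_max_right _ _
      · exact (le_max_left _ _).trans h
      · exact (le_max_right _ _).trans h

/-- comparing norms of inverse -/
theorem norm_inv_le (A B : P2 →L[ℝ] P2) (h : ∀ w, A (B w) = w) : ‖B‖ * |dt A| ≤ 2 * ‖A‖ := by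
  have h0 : dt A * dt B = 1 := by
    rw [← dt_comp, ← dt_id]; congr 1; ext <;> simp [h]
  have hA : dt A ≠ 0 := left_ne_zero_of_mul_eq_one h0
  have hpos : 0 < |dt A| := abs_pos.2 hA
  rw [← le_div_iff₀ hpos]
  have e1 : ∀ w, (B w).1 * dt A = wd w (A (0, 1)) := by
    intro w
    have := wd_map A (B w) (0, 1)
    rw [h] at this
    rw [this]; simp [wd]; ring
  have e2 : ∀ w, (B w).2 * dt A = wd (A (1, 0)) w := by
    intro w
    have := wd_map A (1, 0) (B w)
    rw [h] at this
    rw [this]; simp [wd]; ring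
  have n1 : ‖A (1, 0)‖ ≤ ‖A‖ := by simpa [Prod.norm_def] using A.le_opNorm (1, 0)
  have n2 : ‖A (0, 1)‖ ≤ ‖A‖ := by simpa [Prod.norm_def] using A.le_opNorm (0, 1)
  refine B.opNorm_le_bound (by positivity) fun w => ?_
  rw [Prod.norm_def]
  apply max_le
  · rw [Real.norm_eq_abs, div_mul_eq_mul_div, le_div_iff₀ hpos, ← abs_mul, e1]
    refine (wd_le _ _).trans ?_
    nlinarith [norm_nonneg w]
  · rw [Real.norm_eq_abs, div_mul_eq_mul_div, le_div_iff₀ hpos, ← abs_mul, e2]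
    refine (wd_le _ _).trans ?_
    nlinarith [norm_nonneg w]

/-! exponential rates -/

def Rate (a : ℕ → ℝ) (χ : ℝ) : Prop :=
  Tendsto (fun n : ℕ => (n:ℝ)⁻¹ * Real.log (a n)) atTop (nhds χ)

theorem Rate.bounds {a : ℕ → ℝ} {χ : ℝ} (h : Rate a χ) (ha : ∀ n, 0 < a n) {ε : ℝ} (hε : 0 < ε) :
    ∀ᶠ n : ℕ in atTop, a n ≤ Real.exp ((χ + ε) * n) ∧ Real.exp ((χ - ε) * n) ≤ a n := by
  have h1 : ∀ᶠ n : ℕ in atTop, (n:ℝ)⁻¹ * Real.log (a n) < χ + ε :=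
    h.eventually_lt_const (by linarith)
  have h2 : ∀ᶠ n : ℕ in atTop, χ - ε < (n:ℝ)⁻¹ * Real.log (a n) :=
    h.eventually_const_lt (by linarith)
  filter_upwards [h1, h2, eventually_ge_atTop 1] with n hn1 hn2 hn3
  have hn0 : (0:ℝ) < n := by exact_mod_cast hn3
  rw [inv_mul_lt_iff₀ hn0] at hn1
  rw [lt_inv_mul_iff₀ hn0] at hn2
  constructor
  · rw [← Real.log_le_iff_le_exp (ha n)]; linarith
  · rw [← Real.le_log_iff_exp_le (ha n)]; linarith

theorem Rate.of_bounds {a : ℕ → ℝ} {χ : ℝ} (ha : ∀ n, 0 < a n)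
    (h1 : ∀ ε > 0, ∃ K > 0, ∀ᶠ n : ℕ in atTop, a n ≤ K * Real.exp ((χ + ε) * n))
    (h2 : ∀ ε > 0, ∃ K > 0, ∀ᶠ n : ℕ in atTop, K * Real.exp ((χ - ε) * n) ≤ a n) : Rate a χ := by
  unfold Rate
  rw [Metric.tendsto_atTop']
  intro ε hε
  obtain ⟨K, hK, hK'⟩ := h1 (ε / 2) (by positivity)
  obtain ⟨L, hL, hL'⟩ := h2 (ε / 2) (by positivity)
  have e1 : ∀ᶠ n : ℕ in atTop, Real.log K < ε / 2 * n :=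
    (tendsto_natCast_atTop_atTop.const_mul_atTop (by positivity)).eventually_gt_atTop _
  have e2 : ∀ᶠ n : ℕ in atTop, - Real.log L < ε / 2 * n :=
    (tendsto_natCast_atTop_atTop.const_mul_atTop (by positivity)).eventually_gt_atTop _
  obtain ⟨M, hM⟩ := eventually_atTop.1 ((hK'.and hL').and (e1.and e2))
  refine ⟨M, fun n hn => ?_⟩
  obtain ⟨⟨p1, p2⟩, p3, p4⟩ := hM n hn.le
  have hn0 : (0:ℝ) < n := by
    have : 0 < n := by omega
    exact_mod_cast this
  have q1 := Real.log_le_log (ha n) p1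
  have q2 := Real.log_le_log (by positivity) p2
  rw [Real.log_mul hK.ne' (Real.exp_ne_zero _), Real.log_exp] at q1
  rw [Real.log_mul hL.ne' (Real.exp_ne_zero _), Real.log_exp] at q2
  rw [Real.dist_eq, abs_lt]
  constructor
  · have : χ - ε < (n:ℝ)⁻¹ * Real.log (a n) := by
      rw [lt_inv_mul_iff₀ hn0]
      nlinarith
    linarith
  · have : (n:ℝ)⁻¹ * Real.log (a n) < χ + ε := by
      rw [inv_mul_lt_iff₀ hn0]
      nlinarith
    linarith

theorem osel_vec (A : ℕ → P2 →L[ℝ] P2) (M χ1 χ2 : ℝ) (hM0 : 0 < M)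
    (hM : ∀ n v, ‖A (n + 1) v‖ ≤ M * ‖A n v‖) (hd : ∀ n, dt (A n) ≠ 0) (hA : ∀ n, 0 < ‖A n‖)
    (h1 : Rate (fun n => ‖A n‖) χ1) (h2 : Rate (fun n => |dt (A n)|) (χ1 + χ2)) (hlt : χ2 < χ1) :
    ∃ v : P2, ‖v‖ = 1 ∧
      ∀ ε > 0, ∃ K > 0, ∀ᶠ n : ℕ in atTop, ‖A n v‖ ≤ K * Real.exp ((χ2 + ε) * n) := by
  choose v hv1 hv2 using fun n => exists_small (A n)
  obtain ⟨z, hz, φ, hφ, hlim⟩ := (isCompact_sphere (0 : P2) 1).tendsto_subseq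
    (x := v) (fun n => by simp [hv1])
  have hz1 : ‖z‖ = 1 := by simpa using hz
  refine ⟨z, hz1, ?_⟩
  have hr : ∀ j, |wd (v j) (v (j + 1))| * (‖A j‖ * ‖A (j + 1)‖) ≤ 8 * M * |dt (A j)| := by
    intro j
    have hpos : 0 < |dt (A (j + 1))| := abs_pos.2 (hd _)
    have e1 : |dt (A (j + 1))| * |wd (v j) (v (j + 1))| ≤
        2 * (M * ‖A j (v j)‖) * ‖A (j + 1) (v (j + 1))‖ := by
      rw [← abs_mul, ← wd_map]
      refine (wd_le _ _).trans ?_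
      gcongr
      exact hM j _
    have e2 : |dt (A (j + 1))| * |wd (v j) (v (j + 1))| * (‖A j‖ * ‖A (j + 1)‖) ≤
        2 * M * ((2 * |dt (A j)|) * (2 * |dt (A (j + 1))|)) := by
      calc |dt (A (j + 1))| * |wd (v j) (v (j + 1))| * (‖A j‖ * ‖A (j + 1)‖)
          ≤ 2 * (M * ‖A j (v j)‖) * ‖A (j + 1) (v (j + 1))‖ * (‖A j‖ * ‖A (j + 1)‖) := by gcongr
        _ = 2 * M * ((‖A j (v j)‖ * ‖A j‖) * (‖A (j + 1) (v (j + 1))‖ * ‖A (j + 1)‖)) := by ring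
        _ ≤ _ := by
          exact mul_le_mul_of_nonneg_left (mul_le_mul (hv2 j) (hv2 (j + 1))
            (by positivity) (by positivity)) (by positivity)
    refine le_of_mul_le_mul_left (le_trans (le_of_eq ?_) (e2.trans (le_of_eq ?_))) hpos
    · ring
    · ring
  intro ε hε
  set η := min (ε / 4) ((χ1 - χ2) / 4) with hηd
  have hη : 0 < η := lt_min (by positivity) (by linarith)
  have hη1 : η ≤ ε / 4 := min_le_left _ _
  have hη2 : η ≤ (χ1 - χ2) / 4 := min_le_right _ _
  obtain ⟨N, hN⟩ := eventually_atTop.1 ((h1.bounds hA hη).and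
    (h2.bounds (fun n => abs_pos.2 (hd n)) hη))
  set ρ := Real.exp (χ2 - χ1 + 3 * η) with hρ
  have hρ0 : 0 < ρ := Real.exp_pos _
  have hρ1 : ρ < 1 := by rw [← Real.exp_zero]; exact Real.exp_lt_exp.2 (by linarith)
  set K := 8 * M * Real.exp (-(χ1 - η)) with hK
  have hK0 : 0 < K := by positivity
  have hrj : ∀ j, N ≤ j → |wd (v j) (v (j + 1))| ≤ K * ρ ^ j := by
    intro j hj
    obtain ⟨⟨a1, a2⟩, b1, b2⟩ := hN j hj
    obtain ⟨⟨a1', a2'⟩, b1', b2'⟩ := hN (j + 1) (by omega)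
    have c1 : |wd (v j) (v (j + 1))| *
        (Real.exp ((χ1 - η) * j) * Real.exp ((χ1 - η) * (j + 1 : ℕ))) ≤
        8 * M * Real.exp ((χ1 + χ2 + η) * j) := by
      calc _ ≤ |wd (v j) (v (j + 1))| * (‖A j‖ * ‖A (j + 1)‖) := by gcongr
        _ ≤ 8 * M * |dt (A j)| := hr j
        _ ≤ _ := by gcongr
    have c2 : (K * ρ ^ j) * (Real.exp ((χ1 - η) * j) * Real.exp ((χ1 - η) * (j + 1 : ℕ))) =
        8 * M * Real.exp ((χ1 + χ2 + η) * j) := by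
      rw [hK, hρ, ← Real.exp_nat_mul]
      rw [show 8 * M * Real.exp (-(χ1 - η)) * Real.exp (j * (χ2 - χ1 + 3 * η)) *
        (Real.exp ((χ1 - η) * j) * Real.exp ((χ1 - η) * (j + 1 : ℕ))) = 8 * M *
        (Real.exp (-(χ1 - η)) * Real.exp (j * (χ2 - χ1 + 3 * η)) *
        (Real.exp ((χ1 - η) * j) * Real.exp ((χ1 - η) * (j + 1 : ℕ)))) by ring]
      rw [← Real.exp_add, ← Real.exp_add, ← Real.exp_add]
      congr 2
      push_cast
      ring
    rw [← c2] at c1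
    exact le_of_mul_le_mul_right c1 (by positivity)
  have hsum : ∀ n, N ≤ n → ∀ k, |wd (v n) (v (n + k))| * (1 - ρ) ≤ K * ρ ^ n * (1 - ρ ^ k) := by
    intro n hn k
    induction k with
    | zero => simp [wd, mul_comm]
    | succ k ih =>
      have t1 := wd_tri (v n) (v (n + k)) (v (n + k + 1)) (hv1 _) (hv1 _) (hv1 _)
      have t2 := hrj (n + k) (by omega)
      rw [← add_assoc]
      have h1ρ : 0 ≤ 1 - ρ := by linarith
      calc |wd (v n) (v (n + k + 1))| * (1 - ρ)
          ≤ (|wd (v n) (v (n + k))| + K * ρ ^ (n + k)) * (1 - ρ) := by gcongr; linarith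
        _ ≤ K * ρ ^ n * (1 - ρ ^ k) + K * ρ ^ (n + k) * (1 - ρ) := by linarith
        _ = _ := by rw [pow_add, pow_succ]; ring
  have hzn : ∀ n, N ≤ n → |wd (v n) z| ≤ K / (1 - ρ) * ρ ^ n := by
    intro n hn
    have h1ρ : 0 < 1 - ρ := by linarith
    have c : Continuous (fun u : P2 => |wd (v n) u|) := by unfold wd; fun_prop
    have l := (c.tendsto z).comp hlim
    refine le_of_tendsto l ?_
    filter_upwards [hφ.tendsto_atTop.eventually_ge_atTop n] with k hk
    obtain ⟨m, hm⟩ := Nat.exists_eq_add_of_le hk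
    have := hsum n hn m
    simp only [Function.comp]
    rw [hm, div_mul_eq_mul_div, le_div_iff₀ h1ρ]
    refine this.trans ?_
    have : 0 ≤ K * ρ ^ n * ρ ^ m := by positivity
    linarith
  refine ⟨4 + K / (1 - ρ), ?_, ?_⟩
  · have h1ρ : 0 < 1 - ρ := by linarith
    positivity
  · filter_upwards [eventually_ge_atTop N] with n hn
    obtain ⟨⟨a1, a2⟩, b1, b2⟩ := hN n hn
    have h1ρ : 0 < 1 - ρ := by linarith
    have f1 := norm_le_of_unit (A n) (v n) z (hv1 n) hz1
    have f2 : ‖A n (v n)‖ ≤ 2 * Real.exp ((χ2 + 2 * η) * n) := by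
      have g1 : ‖A n (v n)‖ * Real.exp ((χ1 - η) * n) ≤ 2 * Real.exp ((χ1 + χ2 + η) * n) := by
        calc _ ≤ ‖A n (v n)‖ * ‖A n‖ := by gcongr
          _ ≤ 2 * |dt (A n)| := hv2 n
          _ ≤ _ := by gcongr
      have g2 : 2 * Real.exp ((χ1 + χ2 + η) * n) =
          2 * Real.exp ((χ2 + 2 * η) * n) * Real.exp ((χ1 - η) * n) := by
        rw [mul_assoc, ← Real.exp_add]; congr 2; ring
      rw [g2] at g1
      exact le_of_mul_le_mul_right g1 (Real.exp_pos _)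
    have f3 : |wd (v n) z| * ‖A n‖ ≤ K / (1 - ρ) * Real.exp ((χ2 + 4 * η) * n) := by
      calc _ ≤ K / (1 - ρ) * ρ ^ n * Real.exp ((χ1 + η) * n) := by
            gcongr; exact hzn n hn
        _ = _ := by
            rw [mul_assoc, hρ, ← Real.exp_nat_mul, ← Real.exp_add]; congr 2; ring
    have f4 : Real.exp ((χ2 + 2 * η) * n) ≤ Real.exp ((χ2 + ε) * n) := by
      gcongr; linarith
    have f5 : Real.exp ((χ2 + 4 * η) * n) ≤ Real.exp ((χ2 + ε) * n) := by
      gcongr; linarith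
    have f6 : K / (1 - ρ) * Real.exp ((χ2 + 4 * η) * n) ≤
      K / (1 - ρ) * Real.exp ((χ2 + ε) * n) := by gcongr
    linarith

theorem clm_ne_zero (A : P2 →L[ℝ] P2) (hd : dt A ≠ 0) (u : P2) (hu : u ≠ 0) : 0 < ‖A u‖ := by
  rw [norm_pos_iff]
  intro h
  have h1 := wd_map A u (0, 1)
  have h2 := wd_map A u (1, 0)
  rw [h] at h1 h2
  simp [wd, hd] at h1 h2
  exact hu (Prod.ext h1 h2)

theorem osel (A : ℕ → P2 →L[ℝ] P2) (M χ1 χ2 : ℝ) (hM0 : 0 < M)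
    (hM : ∀ n v, ‖A (n + 1) v‖ ≤ M * ‖A n v‖) (hd : ∀ n, dt (A n) ≠ 0) (hA : ∀ n, 0 < ‖A n‖)
    (h1 : Rate (fun n => ‖A n‖) χ1) (h2 : Rate (fun n => |dt (A n)|) (χ1 + χ2)) (hlt : χ2 < χ1) :
    ∃ v : P2, v ≠ 0 ∧ (∀ c : ℝ, c ≠ 0 → Rate (fun n => ‖A n (c • v)‖) χ2) ∧
      ∀ w, wd v w ≠ 0 → Rate (fun n => ‖A n w‖) χ1 := by
  obtain ⟨v, hv1, hv⟩ := osel_vec A M χ1 χ2 hM0 hM hd hA h1 h2 hlt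
  have hv0 : v ≠ 0 := by
    intro h; simp [h] at hv1
  refine ⟨v, hv0, ?_, ?_⟩
  · intro c hc
    have hcv : c • v ≠ 0 := smul_ne_zero hc hv0
    have hc' : 0 < |c| := abs_pos.2 hc
    refine Rate.of_bounds (fun n => clm_ne_zero _ (hd n) _ hcv) ?_ ?_
    · intro ε hε
      obtain ⟨K, hK, h⟩ := hv ε hε
      refine ⟨|c| * K, by positivity, ?_⟩
      filter_upwards [h] with n hn
      rw [map_smul, norm_smul, Real.norm_eq_abs, mul_assoc]
      gcongr
    · intro ε hε
      obtain ⟨w, hw⟩ : ∃ w, wd v w ≠ 0 := by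
        by_contra hcon
        push Not at hcon
        have e1 := hcon (0, 1)
        have e2 := hcon (1, 0)
        simp [wd] at e1 e2
        exact hv0 (Prod.ext e1 e2)
      have hw0 : 0 < ‖w‖ := by
        rw [norm_pos_iff]; rintro rfl; simp [wd] at hw
      refine ⟨|c| * (|wd v w| / (2 * ‖w‖)), by positivity, ?_⟩
      filter_upwards [h1.bounds hA (half_pos hε), h2.bounds (fun n => abs_pos.2 (hd n))
        (half_pos hε)] with n ha hb
      rw [map_smul, norm_smul, Real.norm_eq_abs, mul_assoc]
      gcongr
      rw [div_mul_eq_mul_div, div_le_iff₀ (by positivity)]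
      have e1 : |dt (A n)| * |wd v w| ≤ 2 * ‖A n v‖ * (‖A n‖ * ‖w‖) := by
        rw [← abs_mul, ← wd_map]
        refine (wd_le _ _).trans ?_
        gcongr
        exact (A n).le_opNorm w
      have e2 : Real.exp ((χ1 + χ2 - ε / 2) * n) * |wd v w| ≤
          2 * ‖A n v‖ * (Real.exp ((χ1 + ε / 2) * n) * ‖w‖) := by
        calc _ ≤ |dt (A n)| * |wd v w| := by gcongr; exact hb.2
          _ ≤ _ := e1
          _ ≤ _ := by gcongr; exact ha.1
      have e3 : Real.exp ((χ1 + χ2 - ε / 2) * n) =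
          Real.exp ((χ2 - ε) * n) * Real.exp ((χ1 + ε / 2) * n) := by
        rw [← Real.exp_add]; congr 1; ring
      rw [e3] at e2
      refine le_of_mul_le_mul_right (le_trans (le_of_eq ?_) (e2.trans (le_of_eq ?_)))
        (Real.exp_pos ((χ1 + ε / 2) * n))
      · ring
      · ring
  · intro w hw
    have hw0 : w ≠ 0 := by rintro rfl; simp [wd] at hw
    have hw1 : 0 < ‖w‖ := norm_pos_iff.2 hw0
    refine Rate.of_bounds (fun n => clm_ne_zero _ (hd n) _ hw0) ?_ ?_
    · intro ε hε
      refine ⟨‖w‖, hw1, ?_⟩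
      filter_upwards [h1.bounds hA hε] with n ha
      refine ((A n).le_opNorm w).trans ?_
      rw [mul_comm]
      gcongr
      exact ha.1
    · intro ε hε
      obtain ⟨K, hK, h⟩ := hv (ε / 2) (half_pos hε)
      refine ⟨|wd v w| / (2 * K), by positivity, ?_⟩
      filter_upwards [h, h2.bounds (fun n => abs_pos.2 (hd n)) (half_pos hε)] with n ha hb
      rw [div_mul_eq_mul_div, div_le_iff₀ (by positivity)]
      have e1 : |dt (A n)| * |wd v w| ≤ 2 * ‖A n v‖ * ‖A n w‖ := by
        rw [← abs_mul, ← wd_map]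
        exact wd_le _ _
      have e2 : Real.exp ((χ1 + χ2 - ε / 2) * n) * |wd v w| ≤
          2 * (K * Real.exp ((χ2 + ε / 2) * n)) * ‖A n w‖ := by
        calc _ ≤ |dt (A n)| * |wd v w| := by gcongr; exact hb.2
          _ ≤ _ := e1
          _ ≤ _ := by gcongr
      have e3 : Real.exp ((χ1 + χ2 - ε / 2) * n) =
          Real.exp ((χ1 - ε) * n) * Real.exp ((χ2 + ε / 2) * n) := by
        rw [← Real.exp_add]; congr 1; ring
      rw [e3] at e2
      refine le_of_mul_le_mul_right (le_trans (le_of_eq ?_) (e2.trans (le_of_eq ?_)))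
        (Real.exp_pos ((χ2 + ε / 2) * n))
      · ring
      · ring

theorem transv (A B C : ℕ → P2 →L[ℝ] P2) (χ1 χ2 : ℝ) (v v' : P2) (hvv : wd v v' ≠ 0)
    (hdA : ∀ n, dt (A n) ≠ 0) (hdB : ∀ n, dt (B n) ≠ 0)
    (hBC : ∀ n w, B n (C n w) = w)
    (a1 : Rate (fun n => ‖A n v‖) χ2) (a2 : Rate (fun n => ‖A n v'‖) χ1)
    (b1 : Rate (fun n => ‖B n v‖) (-χ1)) (b2 : Rate (fun n => ‖B n v'‖) (-χ2))
    (b3 : Rate (fun n => |dt (B n)|) (-(χ1 + χ2))) (ε : ℝ) (hε : 0 < ε) :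
    ∃ K > 0, ∀ᶠ n : ℕ in atTop, ‖(A n).comp (C n)‖ ≤ K * Real.exp ((χ1 + χ2 + ε) * n) := by
  have hv : v ≠ 0 := by rintro rfl; simp [wd] at hvv
  have hv' : v' ≠ 0 := by rintro rfl; simp [wd] at hvv
  have h0 : 0 < |wd v v'| := abs_pos.2 hvv
  have h3 : 0 < ε / 3 := by positivity
  refine ⟨4 / |wd v v'|, by positivity, ?_⟩
  filter_upwards [a1.bounds (fun n => clm_ne_zero _ (hdA n) _ hv) h3,
    a2.bounds (fun n => clm_ne_zero _ (hdA n) _ hv') h3,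
    b1.bounds (fun n => clm_ne_zero _ (hdB n) _ hv) h3,
    b2.bounds (fun n => clm_ne_zero _ (hdB n) _ hv') h3,
    b3.bounds (fun n => abs_pos.2 (hdB n)) h3] with n p1 p2 p3 p4 p5
  refine ContinuousLinearMap.opNorm_le_bound _ (by positivity) fun w => ?_
  set y := C n w with hy
  have hB : B n y = w := hBC n w
  have hd : 0 < |dt (B n)| := abs_pos.2 (hdB n)
  have e1 : |dt (B n)| * |wd v y| ≤ 2 * ‖B n v‖ * ‖w‖ := by
    rw [← abs_mul, ← wd_map, hB]; exact wd_le _ _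
  have e2 : |dt (B n)| * |wd y v'| ≤ 2 * ‖B n v'‖ * ‖w‖ := by
    rw [← abs_mul, ← wd_map, hB]; refine (wd_le _ _).trans (le_of_eq (by ring))
  have e3 : |wd v v'| * ‖A n y‖ ≤ |wd v y| * ‖A n v'‖ + |wd y v'| * ‖A n v‖ := by
    have h := congrArg (fun x => ‖A n x‖) (plucker v y v')
    simp only [map_smul, map_add, norm_smul, Real.norm_eq_abs] at h
    rw [h]
    refine (norm_add_le _ _).trans ?_
    simp [norm_smul]
  have e4 : |dt (B n)| * (|wd v v'| * ‖A n y‖) ≤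
      2 * ‖B n v‖ * ‖w‖ * ‖A n v'‖ + 2 * ‖B n v'‖ * ‖w‖ * ‖A n v‖ := by
    calc _ ≤ |dt (B n)| * (|wd v y| * ‖A n v'‖ + |wd y v'| * ‖A n v‖) := by gcongr
      _ = |dt (B n)| * |wd v y| * ‖A n v'‖ + |dt (B n)| * |wd y v'| * ‖A n v‖ := by ring
      _ ≤ _ := by gcongr
  have e5 : Real.exp ((-(χ1 + χ2) - ε / 3) * n) * (|wd v v'| * ‖A n y‖) ≤
      2 * Real.exp ((-χ1 + ε / 3) * n) * ‖w‖ * Real.exp ((χ1 + ε / 3) * n) +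
      2 * Real.exp ((-χ2 + ε / 3) * n) * ‖w‖ * Real.exp ((χ2 + ε / 3) * n) := by
    calc _ ≤ |dt (B n)| * (|wd v v'| * ‖A n y‖) := by gcongr; exact p5.2
      _ ≤ _ := e4
      _ ≤ _ := by
        gcongr
        · exact p3.1
        · exact p2.1
        · exact p4.1
        · exact p1.1
  have e6 : 2 * Real.exp ((-χ1 + ε / 3) * n) * ‖w‖ * Real.exp ((χ1 + ε / 3) * n) +
      2 * Real.exp ((-χ2 + ε / 3) * n) * ‖w‖ * Real.exp ((χ2 + ε / 3) * n) =
      Real.exp ((-(χ1 + χ2) - ε / 3) * n) * (4 * Real.exp ((χ1 + χ2 + ε) * n) * ‖w‖) := by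
    have k1 : Real.exp ((-χ1 + ε / 3) * n) * Real.exp ((χ1 + ε / 3) * n) =
        Real.exp ((-(χ1 + χ2) - ε / 3) * n) * Real.exp ((χ1 + χ2 + ε) * n) := by
      rw [← Real.exp_add, ← Real.exp_add]; congr 1; ring
    have k2 : Real.exp ((-χ2 + ε / 3) * n) * Real.exp ((χ2 + ε / 3) * n) =
        Real.exp ((-(χ1 + χ2) - ε / 3) * n) * Real.exp ((χ1 + χ2 + ε) * n) := by
      rw [← Real.exp_add, ← Real.exp_add]; congr 1; ring
    linear_combination 2 * ‖w‖ * k1 + 2 * ‖w‖ * k2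
  rw [e6] at e5
  have e7 := le_of_mul_le_mul_left e5 (Real.exp_pos _)
  rw [div_mul_eq_mul_div, div_mul_eq_mul_div, le_div_iff₀ h0]
  rw [ContinuousLinearMap.comp_apply]
  linarith

structure Dif (f g : P2 → P2) : Prop where
  hf : ContDiff ℝ 2 f
  hg : ContDiff ℝ 2 g
  gf : ∀ x, g (f x) = x
  fg : ∀ x, f (g x) = x

theorem Dif.symm {f g : P2 → P2} (h : Dif f g) : Dif g f := ⟨h.hg, h.hf, h.fg, h.gf⟩

theorem Dif.cd {f g : P2 → P2} (h : Dif f g) (n : ℕ) : ContDiff ℝ 2 (f^[n]) := by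
  induction n with
  | zero => exact contDiff_id
  | succ n ih => rw [Function.iterate_succ']; exact h.hf.comp ih

theorem Dif.df {f g : P2 → P2} (h : Dif f g) (n : ℕ) (x : P2) : DifferentiableAt ℝ (f^[n]) x :=
  ((h.cd n).differentiable (by norm_num)) x

theorem Dif.chain {f g : P2 → P2} (h : Dif f g) (m n : ℕ) (x : P2) :
    fderiv ℝ (f^[m + n]) x = (fderiv ℝ (f^[n]) (f^[m] x)).comp (fderiv ℝ (f^[m]) x) := by
  rw [add_comm, Function.iterate_add]
  exact fderiv_comp x (h.df n _) (h.df m x)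

theorem Dif.chain1 {f g : P2 → P2} (h : Dif f g) (n : ℕ) (x : P2) :
    fderiv ℝ (f^[n + 1]) x = (fderiv ℝ f (f^[n] x)).comp (fderiv ℝ (f^[n]) x) := by
  rw [h.chain]; rfl

theorem Dif.chain2 {f g : P2 → P2} (h : Dif f g) (n : ℕ) (x : P2) :
    fderiv ℝ (f^[n + 1]) x = (fderiv ℝ (f^[n]) (f x)).comp (fderiv ℝ f x) := by
  rw [add_comm, h.chain]; rfl

theorem Dif.itinv {f g : P2 → P2} (h : Dif f g) (n : ℕ) (x : P2) : g^[n] (f^[n] x) = x :=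
  Function.LeftInverse.iterate h.gf n x

theorem Dif.inv {f g : P2 → P2} (h : Dif f g) (n : ℕ) (x w : P2) :
    fderiv ℝ (g^[n]) (f^[n] x) (fderiv ℝ (f^[n]) x w) = w := by
  have e : g^[n] ∘ f^[n] = id := by ext1 y; exact h.itinv n y
  have := fderiv_comp x (h.symm.df n (f^[n] x)) (h.df n x)
  rw [e, fderiv_id] at this
  exact (congrArg (fun A : P2 →L[ℝ] P2 => A w) this).symm

theorem Dif.inv' {f g : P2 → P2} (h : Dif f g) (n : ℕ) (x w : P2) :
    fderiv ℝ (f^[n]) x (fderiv ℝ (g^[n]) (f^[n] x) w) = w := by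
  have := h.symm.inv n (f^[n] x) w
  rwa [h.itinv] at this

theorem Dif.inv1 {f g : P2 → P2} (h : Dif f g) (x w : P2) :
    fderiv ℝ g (f x) (fderiv ℝ f x w) = w := h.inv 1 x w

theorem Dif.dtne {f g : P2 → P2} (h : Dif f g) (n : ℕ) (x : P2) : dt (fderiv ℝ (f^[n]) x) ≠ 0 := by
  have : dt (fderiv ℝ (g^[n]) (f^[n] x)) * dt (fderiv ℝ (f^[n]) x) = 1 := by
    rw [← dt_comp, ← dt_id]; congr 1; ext <;> simp [h.inv]
  exact right_ne_zero_of_mul_eq_one this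

theorem Dif.npos {f g : P2 → P2} (h : Dif f g) (n : ℕ) (x : P2) : 0 < ‖fderiv ℝ (f^[n]) x‖ := by
  have := h.dtne n x
  rw [norm_pos_iff]
  intro h0
  apply this
  rw [h0]; simp [dt, wd]

theorem Dif.cont {f g : P2 → P2} (h : Dif f g) (n : ℕ) : Continuous (fun x => fderiv ℝ (f^[n]) x) :=
  (h.cd n).continuous_fderiv (by norm_num)

theorem dt_cont : Continuous dt := by unfold dt wd; fun_prop

theorem Dif.meas_norm {f g : P2 → P2} (h : Dif f g) (n : ℕ) :
    Measurable (fun x => Real.log ‖fderiv ℝ (f^[n]) x‖) :=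
  Real.measurable_log.comp (h.cont n).norm.measurable

theorem Dif.dt_birk {f g : P2 → P2} (h : Dif f g) (n : ℕ) (x : P2) :
    Real.log |dt (fderiv ℝ (f^[n]) x)| =
      ∑ i ∈ Finset.range n, Real.log |dt (fderiv ℝ f (f^[i] x))| := by
  induction n with
  | zero =>
    have : fderiv ℝ (f^[0]) x = ContinuousLinearMap.id ℝ P2 := fderiv_id
    rw [this, dt_id]; simp
  | succ n ih =>
    rw [Finset.sum_range_succ, ← ih, h.chain1, dt_comp, abs_mul, Real.log_mul, add_comm]
    · exact abs_ne_zero.2 (h.dtne 1 _)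
    · exact abs_ne_zero.2 (h.dtne n _)

theorem half (f g : P2 → P2) (h : Dif f g) (μ : Measure P2) [IsProbabilityMeasure μ]
    (he : Ergodic f μ) (K : Set P2) (hK : IsCompact K) (hμ : μ Kᶜ = 0) :
    ∃ χ M C : ℝ, 0 < M ∧
      Tendsto (fun n : ℕ => (∫ x, Real.log ‖fderiv ℝ (f^[n]) x‖ ∂μ) / n) atTop (nhds χ) ∧
      (∀ᵐ x ∂μ, Rate (fun n => ‖fderiv ℝ (f^[n]) x‖) χ) ∧
      (∀ᵐ x ∂μ, ∀ ε > 0, ∀ D : ℕ, ∀ᶠ n : ℕ in atTop, ∀ S ≤ n + D,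
        Real.log ‖fderiv ℝ (f^[n]) (f^[S] x)‖ ≤ n * (χ + ε)) ∧
      (∀ᵐ x ∂μ, Rate (fun n => |dt (fderiv ℝ (f^[n]) x)|)
        (∫ x, Real.log |dt (fderiv ℝ f x)| ∂μ)) ∧
      (∀ᵐ x ∂μ, ∀ n v, ‖fderiv ℝ (f^[n + 1]) x v‖ ≤ M * ‖fderiv ℝ (f^[n]) x v‖) ∧
      (∀ᵐ x ∂μ, abs (Real.log |dt (fderiv ℝ f x)|) ≤ C) ∧
      (∀ᵐ x ∂μ, ∀ n : ℕ, |Real.log ‖fderiv ℝ (f^[n]) x‖| ≤ C * n) := by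
  have c1 : Continuous (fun x => fderiv ℝ f x) := h.cont 1
  have c2 : Continuous (fun x => fderiv ℝ g (f x)) := (h.symm.cont 1).comp h.hf.continuous
  have c3 : Continuous (fun x => Real.log |dt (fderiv ℝ f x)|) :=
    (dt_cont.comp c1).abs.log (fun x => abs_ne_zero.2 (h.dtne 1 x))
  obtain ⟨M1, hM1⟩ := hK.exists_bound_of_continuousOn c1.continuousOn
  obtain ⟨M2, hM2⟩ := hK.exists_bound_of_continuousOn c2.continuousOn
  obtain ⟨M3, hM3⟩ := hK.exists_bound_of_continuousOn c3.continuousOn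
  set M := max 1 (max M1 M2) with hM
  have m0 : 1 ≤ M := le_max_left _ _
  have m1 : M1 ≤ M := (le_max_left _ _).trans (le_max_right _ _)
  have m2 : M2 ≤ M := (le_max_right _ _).trans (le_max_right _ _)
  have hM0 : 0 < M := by linarith
  set C := max (Real.log M) M3
  have hC0 : 0 ≤ C := (Real.log_nonneg m0).trans (le_max_left _ _)
  have hCM : Real.log M ≤ C := le_max_left _ _
  have haeK : ∀ᵐ x ∂μ, x ∈ K := by rw [ae_iff]; exact hμ
  have hae := ae_orbit he.toMeasurePreserving haeK
  have hup : ∀ᵐ x ∂μ, ∀ n v, ‖fderiv ℝ (f^[n + 1]) x v‖ ≤ M * ‖fderiv ℝ (f^[n]) x v‖ := by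
    filter_upwards [hae] with x hx n v
    rw [h.chain1]
    exact ((fderiv ℝ f (f^[n] x)).le_opNorm _).trans 
      (mul_le_mul_of_nonneg_right ((hM1 _ (hx n)).trans m1) (norm_nonneg _))
  have hdn : ∀ᵐ x ∂μ, ∀ n v, ‖fderiv ℝ (f^[n]) x v‖ ≤ M * ‖fderiv ℝ (f^[n + 1]) x v‖ := by
    filter_upwards [hae] with x hx n v
    rw [h.chain1]
    have e := h.inv1 (f^[n] x) (fderiv ℝ (f^[n]) x v)
    calc ‖fderiv ℝ (f^[n]) x v‖ = _ := (congrArg norm e).symm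
      _ ≤ _ := ((fderiv ℝ g (f (f^[n] x))).le_opNorm _).trans
        (mul_le_mul_of_nonneg_right ((hM2 _ (hx n)).trans m2) (norm_nonneg _))
  have hupn : ∀ᵐ x ∂μ, ∀ n, Real.log ‖fderiv ℝ (f^[n + 1]) x‖ ≤
      Real.log ‖fderiv ℝ (f^[n]) x‖ + C := by
    filter_upwards [hup] with x hx n
    have : ‖fderiv ℝ (f^[n + 1]) x‖ ≤ M * ‖fderiv ℝ (f^[n]) x‖ := by
      refine ContinuousLinearMap.opNorm_le_bound _ (by positivity) fun v => (hx n v).trans ?_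
      rw [mul_assoc]; gcongr; exact ContinuousLinearMap.le_opNorm _ _
    have := Real.log_le_log (h.npos _ _) this
    rw [Real.log_mul hM0.ne' (h.npos _ _).ne'] at this
    linarith
  have hdnn : ∀ᵐ x ∂μ, ∀ n, Real.log ‖fderiv ℝ (f^[n]) x‖ ≤
      Real.log ‖fderiv ℝ (f^[n + 1]) x‖ + C := by
    filter_upwards [hdn] with x hx n
    have : ‖fderiv ℝ (f^[n]) x‖ ≤ M * ‖fderiv ℝ (f^[n + 1]) x‖ := by
      refine ContinuousLinearMap.opNorm_le_bound _ (by positivity) fun v => (hx n v).trans ?_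
      rw [mul_assoc]; gcongr; exact ContinuousLinearMap.le_opNorm _ _
    have := Real.log_le_log (h.npos _ _) this
    rw [Real.log_mul hM0.ne' (h.npos _ _).ne'] at this
    linarith
  have hbd : ∀ᵐ x ∂μ, ∀ n : ℕ, |Real.log ‖fderiv ℝ (f^[n]) x‖| ≤ C * n := by
    filter_upwards [hupn, hdnn] with x h1 h2 n
    induction n with
    | zero =>
      have : fderiv ℝ (f^[0]) x = ContinuousLinearMap.id ℝ P2 := fderiv_id
      rw [this, ContinuousLinearMap.norm_id]; simp
    | succ n ih =>
      have a := h1 n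
      have b := h2 n
      rw [abs_le] at ih ⊢
      push_cast
      constructor <;> linarith [ih.1, ih.2]
  obtain ⟨χ, k1, k2, k3⟩ := kc_full μ f he (fun n x => Real.log ‖fderiv ℝ (f^[n]) x‖)
    h.meas_norm C hC0 (by
      intro m n x
      rw [h.chain, ← Real.log_mul (h.npos _ _).ne' (h.npos _ _).ne']
      refine Real.log_le_log ?_ ?_
      · rw [← h.chain]; exact h.npos _ _
      · rw [mul_comm]; exact ContinuousLinearMap.opNorm_comp_le _ _) hbd hdnn
  have hb3 : ∀ᵐ x ∂μ, abs (Real.log |dt (fderiv ℝ f x)|) ≤ C := by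
    filter_upwards [haeK] with x hx
    exact (hM3 x hx).trans (le_max_right _ _)
  refine ⟨χ, M, C, hM0, k1, k2, k3, ?_, hup, hb3, hbd⟩
  filter_upwards [bk_tendsto μ f he _ c3.measurable C hb3] with x hx
  unfold Rate
  simpa only [h.dt_birk] using hx

def Dif.homeo {f g : P2 → P2} (h : Dif f g) : P2 ≃ₜ P2 where
  toFun := f
  invFun := g
  left_inv := h.gf
  right_inv := h.fg
  continuous_toFun := h.hf.continuous
  continuous_invFun := h.hg.continuous

theorem Dif.emb {f g : P2 → P2} (h : Dif f g) : MeasurableEmbedding f :=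
  h.homeo.measurableEmbedding

theorem Dif.ergodic {f g : P2 → P2} (h : Dif f g) (μ : Measure P2)
    (he : Ergodic f μ) : Ergodic g μ := by
  have : Ergodic h.homeo.toMeasurableEquiv μ := he
  exact this.symm

theorem Dif.int_comp {f g : P2 → P2} (h : Dif f g) (μ : Measure P2)
    (he : Ergodic f μ) (n : ℕ) (φ : P2 → ℝ) : ∫ x, φ (f^[n] x) ∂μ = ∫ x, φ x ∂μ := by
  induction n with
  | zero => rfl
  | succ n ih =>
    rw [← ih]
    exact he.toMeasurePreserving.integral_comp h.emb (fun x => φ (f^[n] x))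

theorem Dif.dt_inv {f g : P2 → P2} (h : Dif f g) (n : ℕ) (x : P2) :
    Real.log |dt (fderiv ℝ (g^[n]) (f^[n] x))| = - Real.log |dt (fderiv ℝ (f^[n]) x)| := by
  have : dt (fderiv ℝ (g^[n]) (f^[n] x)) * dt (fderiv ℝ (f^[n]) x) = 1 := by
    rw [← dt_comp, ← dt_id]; congr 1; ext <;> simp [h.inv]
  have h2 := congrArg (fun t => Real.log |t|) this
  simp only [abs_mul, abs_one, Real.log_one] at h2
  rw [Real.log_mul (abs_ne_zero.2 (left_ne_zero_of_mul_eq_one this))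
    (abs_ne_zero.2 (right_ne_zero_of_mul_eq_one this))] at h2
  linarith

theorem Dif.norm_inv1 {f g : P2 → P2} (h : Dif f g) (n : ℕ) (x : P2) :
    Real.log ‖fderiv ℝ (g^[n]) (f^[n] x)‖ + Real.log |dt (fderiv ℝ (f^[n]) x)| ≤
      Real.log 2 + Real.log ‖fderiv ℝ (f^[n]) x‖ := by
  have := norm_inv_le (fderiv ℝ (f^[n]) x) (fderiv ℝ (g^[n]) (f^[n] x)) (h.inv' n x)
  have p := h.symm.npos n (f^[n] x)
  have q := abs_pos.2 (h.dtne n x)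
  have := Real.log_le_log (mul_pos p q) this
  rwa [Real.log_mul p.ne' q.ne', Real.log_mul two_ne_zero (h.npos n x).ne'] at this

theorem Dif.norm_inv2 {f g : P2 → P2} (h : Dif f g) (n : ℕ) (x : P2) :
    Real.log ‖fderiv ℝ (f^[n]) x‖ ≤ Real.log 2 +
      (Real.log ‖fderiv ℝ (g^[n]) (f^[n] x)‖ + Real.log |dt (fderiv ℝ (f^[n]) x)|) := by
  have := h.symm.norm_inv1 n (f^[n] x)
  rw [h.itinv, h.dt_inv] at this
  linarith

theorem both (f g : P2 → P2) (h : Dif f g) (μ : Measure P2) [IsProbabilityMeasure μ]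
    (he : Ergodic f μ) (C C' χ χ' : ℝ)
    (h1 : Tendsto (fun n : ℕ => (∫ x, Real.log ‖fderiv ℝ (f^[n]) x‖ ∂μ) / n) atTop (nhds χ))
    (h1' : Tendsto (fun n : ℕ => (∫ x, Real.log ‖fderiv ℝ (g^[n]) x‖ ∂μ) / n) atTop (nhds χ'))
    (h2 : ∀ᵐ x ∂μ, abs (Real.log |dt (fderiv ℝ f x)|) ≤ C)
    (h3 : ∀ᵐ x ∂μ, ∀ n : ℕ, |Real.log ‖fderiv ℝ (f^[n]) x‖| ≤ C * n)
    (h3' : ∀ᵐ x ∂μ, ∀ n : ℕ, |Real.log ‖fderiv ℝ (g^[n]) x‖| ≤ C' * n) :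
    (∫ x, Real.log |dt (fderiv ℝ g x)| ∂μ) = - ∫ x, Real.log |dt (fderiv ℝ f x)| ∂μ ∧
    χ' = χ - ∫ x, Real.log |dt (fderiv ℝ f x)| ∂μ := by
  set δ := ∫ x, Real.log |dt (fderiv ℝ f x)| ∂μ with hδ
  have c1 : Continuous (fun x => fderiv ℝ f x) := h.cont 1
  have c3 : Continuous (fun x => Real.log |dt (fderiv ℝ f x)|) :=
    (dt_cont.comp c1).abs.log (fun x => abs_ne_zero.2 (h.dtne 1 x))
  constructor
  · rw [← h.int_comp μ he 1, hδ, ← integral_neg]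
    congr 1; ext1 x
    exact h.dt_inv 1 x
  have hit : ∀ n, Integrable (fun x => Real.log |dt (fderiv ℝ f (f^[n] x))|) μ := by
    intro n
    refine Integrable.of_bound (C := C) ?_ ?_
    · exact (c3.comp (h.cd n).continuous).measurable.aestronglyMeasurable
    · filter_upwards [ae_orbit he.toMeasurePreserving h2] with x hx
      exact hx n
  have hdt : ∀ n : ℕ, ∫ x, Real.log |dt (fderiv ℝ (f^[n]) x)| ∂μ = n * δ := by
    intro n
    simp only [h.dt_birk]
    rw [integral_finsetSum _ (fun i _ => hit i)]
    rw [Finset.sum_congr rfl (fun i _ => h.int_comp μ he i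
      (fun x => Real.log |dt (fderiv ℝ f x)|))]
    simp [hδ]
  have hdi : ∀ n : ℕ, Integrable (fun x => Real.log |dt (fderiv ℝ (f^[n]) x)|) μ := by
    intro n
    simp only [h.dt_birk]
    exact integrable_finsetSum _ (fun i _ => hit i)
  have i1 : ∀ n : ℕ, Integrable (fun x => Real.log ‖fderiv ℝ (f^[n]) x‖) μ := fun n =>
    Integrable.of_bound (h.meas_norm n).aestronglyMeasurable (C * n)
      (by filter_upwards [h3] with x hx using hx n)
  have i2 : ∀ n : ℕ, Integrable (fun x => Real.log ‖fderiv ℝ (g^[n]) (f^[n] x)‖) μ := fun n => by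
    refine Integrable.of_bound
      (((h.symm.meas_norm n).comp (h.cd n).continuous.measurable).aestronglyMeasurable) (C' * n) ?_
    filter_upwards [ae_orbit he.toMeasurePreserving h3'] with x hx using hx n n
  have key : ∀ n : ℕ, |(∫ x, Real.log ‖fderiv ℝ (g^[n]) x‖ ∂μ) -
      ((∫ x, Real.log ‖fderiv ℝ (f^[n]) x‖ ∂μ) - n * δ)| ≤ Real.log 2 := by
    intro n
    rw [← h.int_comp μ he n, ← hdt n, ← integral_sub (i1 n) (hdi n),
      ← integral_sub (i2 n) (show Integrable (fun x => Real.log ‖fderiv ℝ (f^[n]) x‖ -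
        Real.log |dt (fderiv ℝ (f^[n]) x)|) μ from (i1 n).sub (hdi n))]
    have : ‖∫ x, (Real.log ‖fderiv ℝ (g^[n]) (f^[n] x)‖ - (Real.log ‖fderiv ℝ (f^[n]) x‖ -
      Real.log |dt (fderiv ℝ (f^[n]) x)|)) ∂μ‖ ≤ Real.log 2 * μ.real Set.univ := by
      refine norm_integral_le_of_norm_le_const (Eventually.of_forall fun x => ?_)
      have a := h.norm_inv1 n x
      have b := h.norm_inv2 n x
      rw [Real.norm_eq_abs, abs_le]
      constructor <;> linarith
    simpa using this
  have lim : Tendsto (fun n : ℕ => ((∫ x, Real.log ‖fderiv ℝ (g^[n]) x‖ ∂μ) -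
      ((∫ x, Real.log ‖fderiv ℝ (f^[n]) x‖ ∂μ) - n * δ)) / n) atTop (nhds 0) := by
    refine squeeze_zero_norm (a := fun n : ℕ => Real.log 2 / n) (fun n => ?_)
      (tendsto_const_div_atTop_nhds_zero_nat _)
    rw [norm_div, Real.norm_natCast]
    gcongr
    exact key n
  have lim2 : Tendsto (fun n : ℕ => ((∫ x, Real.log ‖fderiv ℝ (g^[n]) x‖ ∂μ) -
      ((∫ x, Real.log ‖fderiv ℝ (f^[n]) x‖ ∂μ) - n * δ)) / n) atTop (nhds (χ' - χ + δ)) := by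
    refine ((h1'.sub h1).add_const δ).congr' ?_
    filter_upwards [eventually_ge_atTop 1] with n hn
    have : (n:ℝ) ≠ 0 := by positivity
    field_simp
    ring
  have := tendsto_nhds_unique lim lim2
  linarith

theorem ae_nonwandering (f : P2 → P2) (μ : Measure P2) [IsProbabilityMeasure μ]
    (he : Ergodic f μ) : ∀ᵐ x ∂μ, x ∈ nonwanderingSet f := by
  filter_upwards [he.toMeasurePreserving.conservative.ae_frequently_mem_of_mem_nhds]
    with x hx U hU hxU
  obtain ⟨n, hn, hn2⟩ := (frequently_atTop.1 (hx U (hU.mem_nhds hxU))) 1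
  exact ⟨n, hn, f^[n] x, ⟨x, hxU, rfl⟩, hn2⟩

theorem lower_aux (f g : P2 → P2) (h : Dif f g) (x : P2) (χ c : ℝ)
    (hx : ∀ ε > 0, ∀ D : ℕ, ∀ᶠ n : ℕ in atTop, ∀ S ≤ n + D,
        Real.log ‖fderiv ℝ (f^[n]) (f^[S] x)‖ ≤ n * (χ + ε))
    (D : ℕ) (hD : ∀ N : ℕ, ∃ n ≥ N, ∃ S ≤ n + D,
      Real.exp (c * n) ≤ ‖fderiv ℝ (f^[n]) (f^[S] x) (1, 0)‖) : c ≤ χ := by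
  refine le_of_forall_pos_le_add fun ε hε => ?_
  obtain ⟨N, hN⟩ := eventually_atTop.1 (hx ε hε D)
  obtain ⟨n, hn, S, hS, hh⟩ := hD (max N 1)
  have h1 := hN n ((le_max_left _ _).trans hn) S hS
  have hn1 : 1 ≤ n := (le_max_right _ _).trans hn
  have h2 : ‖fderiv ℝ (f^[n]) (f^[S] x) (1, 0)‖ ≤ ‖fderiv ℝ (f^[n]) (f^[S] x)‖ := by
    refine (ContinuousLinearMap.le_opNorm _ _).trans ?_
    simp [Prod.norm_def]
  have h3 : c * n ≤ Real.log ‖fderiv ℝ (f^[n]) (f^[S] x)‖ := by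
    rw [Real.le_log_iff_exp_le (h.npos _ _)]
    exact hh.trans h2
  have hn0 : (0:ℝ) < n := by exact_mod_cast hn1
  nlinarith

theorem lower (f g : P2 → P2) (h : Dif f g) (x : P2) (χ c : ℝ)
    (hx : ∀ ε > 0, ∀ D : ℕ, ∀ᶠ n : ℕ in atTop, ∀ S ≤ n + D,
        Real.log ‖fderiv ℝ (f^[n]) (f^[S] x)‖ ≤ n * (χ + ε))
    (hd : (∃ nubar : ℕ, {n : ℕ | 1 ≤ n ∧
          Real.exp (c * ((n : ℝ) - 1)) ≤
            ‖wvec f (f^[nubar] x) n‖}.Infinite) ∨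
      (∃ ν : ℕ → ℕ, 0 < ν 1 ∧ (∀ l, 1 ≤ l → 2 * ν l ≤ ν (l + 1)) ∧
        ∀ l : ℕ,
          Real.exp (c * ((ν (l + 1) : ℝ) - 1)) ≤
            ‖wvec f (f^[∑ i ∈ Finset.range (l + 1), ν i] x) (ν (l + 1))‖)) : c ≤ χ := by
  rcases hd with ⟨nb, hinf⟩ | ⟨ν, h1, h2, h3⟩
  · refine lower_aux f g h x χ c hx (nb + 1) fun N => ?_
    obtain ⟨n, ⟨hn1, hn2⟩, hn3⟩ := hinf.exists_gt N
    refine ⟨n - 1, by omega, nb + 1, by omega, ?_⟩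
    rw [Function.iterate_succ_apply']
    rw [Nat.cast_sub hn1, Nat.cast_one]
    exact hn2
  · have hS : ∀ l, ∑ i ∈ Finset.range (l + 1), ν i ≤ ν 0 + ν (l + 1) := by
      intro l
      induction l with
      | zero => simp
      | succ l ih =>
        rw [Finset.sum_range_succ]
        have := h2 (l + 1) (by omega)
        omega
    have hg : ∀ l, l + 1 ≤ ν (l + 1) := by
      intro l
      induction l with
      | zero => exact h1
      | succ l ih =>
        have := h2 (l + 1) (by omega)
        omega
    refine lower_aux f g h x χ c hx (ν 0 + 2) fun N => ?_
    have a := hg N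
    have b := hS N
    refine ⟨ν (N + 1) - 1, by omega, ∑ i ∈ Finset.range (N + 1), ν i + 1, by omega, ?_⟩
    rw [Function.iterate_succ_apply']
    rw [Nat.cast_sub (by omega), Nat.cast_one]
    exact h3 N

theorem wd_zero (v u : P2) (hv : v ≠ 0) (h : wd v u = 0) : ∃ c : ℝ, u = c • v := by
  have hne : wd v (-v.2, v.1) ≠ 0 := by
    intro h0
    simp only [wd] at h0
    apply hv
    ext <;> simp <;> nlinarith [sq_nonneg v.1, sq_nonneg v.2]
  have := plucker v u (-v.2, v.1)
  rw [h, zero_smul, zero_add] at this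
  refine ⟨(wd v (-v.2, v.1))⁻¹ * wd u (-v.2, v.1), ?_⟩
  rw [mul_smul, ← this, smul_smul, inv_mul_cancel₀ hne, one_smul]

theorem wd_perp (v : P2) (hv : v ≠ 0) : wd v (-v.2, v.1) ≠ 0 := by
  intro h0
  simp only [wd] at h0
  apply hv
  ext <;> simp <;> nlinarith [sq_nonneg v.1, sq_nonneg v.2]

theorem wd_smul_left (c : ℝ) (v w : P2) : wd (c • v) w = c * wd v w := by
  simp [wd]; ring

theorem Rate.tendsto_zero {a : ℕ → ℝ} {χ : ℝ} (h : Rate a χ) (ha : ∀ n, 0 < a n) (hχ : χ < 0) :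
    Tendsto a atTop (nhds 0) := by
  have e := h.bounds ha (ε := -χ / 2) (by linarith)
  refine squeeze_zero' (Eventually.of_forall fun n => (ha n).le) (e.mono fun n hn => hn.1) ?_
  refine Real.tendsto_exp_atBot.comp ?_
  exact tendsto_natCast_atTop_atTop.const_mul_atTop_of_neg (by linarith)

theorem Rate.not_tendsto_zero {a : ℕ → ℝ} {χ : ℝ} (h : Rate a χ) (ha : ∀ n, 0 < a n) (hχ : 0 < χ) :
    ¬ Tendsto a atTop (nhds 0) := by
  intro ht
  have e := h.bounds ha (ε := χ / 2) (by linarith)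
  obtain ⟨n, h1, h2⟩ := (e.and (ht.eventually_lt_const one_pos)).exists
  have : 1 ≤ Real.exp ((χ - χ / 2) * n) := Real.one_le_exp (mul_nonneg (by linarith) (by positivity))
  linarith [h1.2]

theorem ae_rec (f g : P2 → P2) (h : Dif f g) (μ : Measure P2) [IsProbabilityMeasure μ]
    (he : Ergodic f μ) (χ η : ℝ) (hη : 0 < η)
    (hr : ∀ᵐ x ∂μ, Rate (fun n => ‖fderiv ℝ (f^[n]) x‖) χ) :
    ∀ᵐ x ∂μ, ∀ k : ℕ, ∃ n ≥ k, Real.exp ((χ - η) * (n + n : ℕ)) ≤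
      ‖fderiv ℝ (f^[n + n]) (g^[n] x)‖ := by
  set Bad : ℕ → Set P2 := fun n => {x | ‖fderiv ℝ (f^[n + n]) x‖ < Real.exp ((χ - η) * (n + n : ℕ))}
    with hBad
  have hm : ∀ n, MeasurableSet (Bad n) := fun n =>
    measurableSet_lt (h.cont _).norm.measurable measurable_const
  have hlim : Tendsto (fun n => μ (Bad n)) atTop (nhds (μ ∅)) := by
    refine tendsto_measure_of_ae_tendsto_indicator_of_isFiniteMeasure atTop MeasurableSet.empty
      hm ?_
    filter_upwards [hr] with x hx
    have e := hx.bounds (fun n => h.npos n x) hη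
    have t : Tendsto (fun n : ℕ => n + n) atTop atTop :=
      tendsto_atTop_mono (fun n => Nat.le_add_right n n) tendsto_id
    filter_upwards [t.eventually e] with n hn
    simp only [Set.mem_empty_iff_false, iff_false]
    exact not_lt.2 hn.2
  rw [measure_empty] at hlim
  rw [ae_all_iff]
  intro k
  rw [ae_iff]
  have hg := (h.ergodic μ he).toMeasurePreserving
  refine le_antisymm (ge_of_tendsto hlim ?_) zero_le
  filter_upwards [eventually_ge_atTop k] with n hn
  rw [← (hg.iterate n).measure_preimage (hm n).nullMeasurableSet]
  refine measure_mono fun x hx => ?_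
  have hx' : ¬ ∃ n ≥ k, Real.exp ((χ - η) * (n + n : ℕ)) ≤
      ‖fderiv ℝ (f^[n + n]) (g^[n] x)‖ := hx
  by_contra hc
  exact hx' ⟨n, hn, not_lt.1 hc⟩

def stab (f : P2 → P2) (x : P2) : P2 :=
  open Classical in
  if h : ∃ v : P2, v ≠ 0 ∧ Tendsto (fun n : ℕ => ‖fderiv ℝ (f^[n]) x v‖) atTop (nhds 0)
  then h.choose else 0

theorem stab_spec (f g : P2 → P2) (h : Dif f g) (x v : P2) (χ1 χ2 : ℝ) (h1 : 0 < χ1) (h2 : χ2 < 0)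
    (hv : v ≠ 0) (hs : ∀ c : ℝ, c ≠ 0 → Rate (fun n => ‖fderiv ℝ (f^[n]) x (c • v)‖) χ2)
    (hu : ∀ w, wd v w ≠ 0 → Rate (fun n => ‖fderiv ℝ (f^[n]) x w‖) χ1) :
    ∃ c : ℝ, c ≠ 0 ∧ stab f x = c • v ∧
      Tendsto (fun n : ℕ => ‖fderiv ℝ (f^[n]) x (stab f x)‖) atTop (nhds 0) ∧
      ∀ w, Tendsto (fun n : ℕ => ‖fderiv ℝ (f^[n]) x w‖) atTop (nhds 0) →
        ∃ c : ℝ, w = c • stab f x := by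
  have pos : ∀ w, w ≠ 0 → ∀ n, 0 < ‖fderiv ℝ (f^[n]) x w‖ := fun w hw n =>
    clm_ne_zero _ (h.dtne n x) w hw
  have hex : ∃ v : P2, v ≠ 0 ∧ Tendsto (fun n : ℕ => ‖fderiv ℝ (f^[n]) x v‖) atTop (nhds 0) := by
    refine ⟨v, hv, ?_⟩
    have := hs 1 one_ne_zero
    rw [one_smul] at this
    exact this.tendsto_zero (pos v hv) h2
  have key : ∀ w, Tendsto (fun n : ℕ => ‖fderiv ℝ (f^[n]) x w‖) atTop (nhds 0) → 
      ∃ c : ℝ, w = c • v := by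
    intro w hw
    refine wd_zero v w hv ?_
    by_contra hc
    have hw0 : w ≠ 0 := by rintro rfl; simp [wd] at hc
    exact (hu w hc).not_tendsto_zero (pos w hw0) h1 hw
  have e : stab f x = hex.choose := by rw [stab, dif_pos hex]
  have hsp := hex.choose_spec
  rw [← e] at hsp
  obtain ⟨c, hc⟩ := key _ hsp.2
  have hc0 : c ≠ 0 := by rintro rfl; apply hsp.1; rw [hc, zero_smul]
  refine ⟨c, hc0, hc, hsp.2, fun w hw => ?_⟩
  obtain ⟨d, hd⟩ := key w hw
  exact ⟨d * c⁻¹, by rw [hd, hc, smul_smul, mul_assoc, inv_mul_cancel₀ hc0, mul_one]⟩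

theorem not_par (f g : P2 → P2) (h : Dif f g) (x v u : P2) (χ1 χ2 : ℝ) (hlt : χ2 < χ1)
    (hrec : ∀ k : ℕ, ∃ n ≥ k, Real.exp ((χ1 - (χ1 - χ2) / 4) * (n + n : ℕ)) ≤
      ‖fderiv ℝ (f^[n + n]) (g^[n] x)‖)
    (hd : Rate (fun n => |dt (fderiv ℝ (g^[n]) x)|) (-(χ1 + χ2)))
    (hv : v ≠ 0) (hu : u ≠ 0)
    (v1 : ∀ c : ℝ, c ≠ 0 → Rate (fun n => ‖fderiv ℝ (f^[n]) x (c • v)‖) χ2)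
    (v2 : ∀ w, wd v w ≠ 0 → Rate (fun n => ‖fderiv ℝ (f^[n]) x w‖) χ1)
    (u1 : ∀ c : ℝ, c ≠ 0 → Rate (fun n => ‖fderiv ℝ (g^[n]) x (c • u)‖) (-χ1))
    (u2 : ∀ w, wd u w ≠ 0 → Rate (fun n => ‖fderiv ℝ (g^[n]) x w‖) (-χ2)) : wd v u ≠ 0 := by
  intro h0
  obtain ⟨c, hc⟩ := wd_zero v u hv h0
  have hc0 : c ≠ 0 := by rintro rfl; apply hu; rw [hc, zero_smul]
  have hvp := wd_perp v hv
  have r1 := v1 1 one_ne_zero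
  rw [one_smul] at r1
  have r3 := u1 c⁻¹ (inv_ne_zero hc0)
  rw [hc, smul_smul, inv_mul_cancel₀ hc0, one_smul] at r3
  have r4 := u2 (-v.2, v.1) (by rw [hc, wd_smul_left]; exact mul_ne_zero hc0 hvp)
  obtain ⟨K, hK, hev⟩ := transv (fun n => fderiv ℝ (f^[n]) x) (fun n => fderiv ℝ (g^[n]) x)
    (fun n => fderiv ℝ (f^[n]) (g^[n] x)) χ1 χ2 v (-v.2, v.1) hvp (fun n => h.dtne n x)
    (fun n => h.symm.dtne n x) (fun n w => h.symm.inv' n x w) r1 (v2 _ hvp) r3 r4 hd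
    ((χ1 - χ2) / 4) (by linarith)
  have ht : Tendsto (fun n : ℕ => Real.exp ((χ1 - χ2) / 4 * n)) atTop atTop :=
    Real.tendsto_exp_atTop.comp
      (tendsto_natCast_atTop_atTop.const_mul_atTop (by linarith))
  obtain ⟨N, hN⟩ := eventually_atTop.1 (hev.and (ht.eventually_gt_atTop K))
  obtain ⟨n, hn, hn2⟩ := hrec N
  obtain ⟨a, b⟩ := hN n hn
  rw [h.chain, h.symm.itinv] at hn2
  have c1 := hn2.trans a
  have c2 : Real.exp ((χ1 - (χ1 - χ2) / 4) * (n + n : ℕ)) =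
      Real.exp ((χ1 - χ2) / 4 * n) * Real.exp ((χ1 + χ2 + (χ1 - χ2) / 4) * n) := by
    rw [← Real.exp_add]; congr 1; push_cast; ring
  rw [c2] at c1
  have := le_of_mul_le_mul_right c1 (Real.exp_pos _)
  linarith

theorem topZ (f g : P2 → P2) (x e : P2) (χ : ℝ)
    (h : Rate (fun n => ‖fderiv ℝ (f^[n]) x e‖) χ) :
    Tendsto (fun n : ℤ => ((n : ℝ))⁻¹ * Real.log ‖DiterZ f g x n e‖) atTop (nhds χ) := by
  have t : Tendsto Int.toNat atTop atTop := by
    refine tendsto_atTop.2 fun b => ?_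
    filter_upwards [eventually_ge_atTop (b : ℤ)] with n hn
    omega
  refine (h.comp t).congr' ?_
  filter_upwards [eventually_ge_atTop (0 : ℤ)] with n hn
  have e1 : ((n.toNat : ℕ) : ℝ) = (n : ℝ) := by
    rw [← Int.cast_natCast, Int.toNat_of_nonneg hn]
  simp only [Function.comp, DiterZ, if_pos hn, e1]

theorem botZ (f g : P2 → P2) (x e : P2) (χ : ℝ)
    (h : Rate (fun n => ‖fderiv ℝ (g^[n]) x e‖) (-χ)) :
    Tendsto (fun n : ℤ => ((n : ℝ))⁻¹ * Real.log ‖DiterZ f g x n e‖) atBot (nhds χ) := by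
  have t : Tendsto (fun n : ℤ => (-n).toNat) atBot atTop := by
    refine tendsto_atTop.2 fun b => ?_
    filter_upwards [eventually_le_atBot (-(b : ℤ))] with n hn
    omega
  have h' := (h.comp t).neg
  rw [neg_neg] at h'
  refine h'.congr' ?_
  filter_upwards [eventually_lt_atBot (0 : ℤ)] with n hn
  have e1 : (((-n).toNat : ℕ) : ℝ) = -(n : ℝ) := by
    rw [← Int.cast_natCast, Int.toNat_of_nonneg (by omega), Int.cast_neg]
  simp only [Function.comp, DiterZ, if_neg (not_le.2 hn), e1, inv_neg]
  ring

theorem linind (u v : P2) (h : wd u v ≠ 0) : LinearIndependent ℝ ![u, v] := by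
  rw [LinearIndependent.pair_iff]
  intro s t hst
  have h1 := congrArg Prod.fst hst
  have h2 := congrArg Prod.snd hst
  simp only [Prod.fst_add, Prod.snd_add, Prod.smul_fst, Prod.smul_snd, smul_eq_mul,
    Prod.fst_zero, Prod.snd_zero] at h1 h2
  constructor
  · refine (mul_eq_zero.1 (?_ : s * wd u v = 0)).resolve_right h
    unfold wd; linear_combination v.2 * h1 - v.1 * h2
  · refine (mul_eq_zero.1 (?_ : t * wd u v = 0)).resolve_right h
    unfold wd; linear_combination u.1 * h2 - u.2 * h1

theorem stmt2 (b : ℝ) (hb0 : 0 < b) (hb1 : b < 1)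
    (f g : P2 → P2) (hf : ContDiff ℝ 2 f) (hg : ContDiff ℝ 2 g)
    (hgf : Function.LeftInverse g f) (hfg : Function.RightInverse g f)
    (hdet : ∀ x : P2, |LinearMap.det ((fderiv ℝ f x).toLinearMap)| ≤ b)
    (hnoattr : ¬ ∃ (p : P2) (N m : ℕ), 1 ≤ N ∧ 1 ≤ m ∧ f^[N] p = p ∧
      ‖(fderiv ℝ (f^[N]) p) ^ m‖ < 1)
    (hdich : ∀ x ∈ nonwanderingSet f,
      (∃ nubar : ℕ, {n : ℕ | 1 ≤ n ∧
          Real.exp ((Real.log 2 / 4) * ((n : ℝ) - 1)) ≤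
            ‖wvec f (f^[nubar] x) n‖}.Infinite) ∨
      (∃ ν : ℕ → ℕ, 0 < ν 1 ∧ (∀ l, 1 ≤ l → 2 * ν l ≤ ν (l + 1)) ∧
        ∀ l : ℕ,
          Real.exp ((Real.log 2 / 4) * ((ν (l + 1) : ℝ) - 1)) ≤
            ‖wvec f (f^[∑ i ∈ Finset.range (l + 1), ν i] x) (ν (l + 1))‖))
    (μ : Measure P2) [IsProbabilityMeasure μ] (herg : Ergodic f μ)
    (hsupp : ∃ K : Set P2, IsCompact K ∧ μ Kᶜ = 0) :
    ∃ χs χu : ℝ, HasTwoLyapunovExponents f g μ χs χu ∧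
      χs < (1 / 3) * Real.log b ∧ (1 / 3) * Real.log b < 0 ∧
      (1 / 4) * Real.log 2 ≤ χu ∧ χs < 0 ∧ 0 < χu := by
  have h : Dif f g := ⟨hf, hg, hgf, hfg⟩
  obtain ⟨K, hK, hμ⟩ := hsupp
  have herg' := h.ergodic μ herg
  obtain ⟨χ1, M, C, hM, k1, k2, k3, k4, k5, k6, k7⟩ := half f g h μ herg K hK hμ
  obtain ⟨χ', M', C', hM', k1', k2', k3', k4', k5', k6', k7'⟩ := half g f h.symm μ herg' K hK hμ
  obtain ⟨b1, b2⟩ := both f g h μ herg C C' χ1 χ' k1 k1' k6 k7 k7'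
  rw [b1] at k4'
  set δ := ∫ x, Real.log |dt (fderiv ℝ f x)| ∂μ with hδ
  have hδb : δ ≤ Real.log b := by
    have c1 : Continuous (fun x => fderiv ℝ f x) := h.cont 1
    have c3 : Continuous (fun x => Real.log |dt (fderiv ℝ f x)|) :=
      (dt_cont.comp c1).abs.log (fun x => abs_ne_zero.2 (h.dtne 1 x))
    have hi : Integrable (fun x => Real.log |dt (fderiv ℝ f x)|) μ :=
      Integrable.of_bound c3.measurable.aestronglyMeasurable C k6
    have := integral_mono hi (integrable_const (Real.log b)) (fun x => by
      have := hdet x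
      rw [dt_eq_det] at this
      exact Real.log_le_log (abs_pos.2 (h.dtne 1 x)) this)
    rw [integral_const] at this
    simpa only [probReal_univ, one_smul] using this
  have hlow : Real.log 2 / 4 ≤ χ1 := by
    obtain ⟨x, hx1, hx2⟩ := ((ae_nonwandering f μ herg).and k3).exists
    exact lower f g h x χ1 _ hx2 (hdich x hx1)
  have hl2 : 0 < Real.log 2 := Real.log_pos (by norm_num)
  have hlb : Real.log b < 0 := Real.log_neg hb0 hb1
  set χ2 := δ - χ1 with hχ2
  have hχ1 : 0 < χ1 := by linarith
  have hχ2n : χ2 < 0 := by linarith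
  have hlt : χ2 < χ1 := by linarith
  have hrec := ae_rec f g h μ herg χ1 ((χ1 - χ2) / 4) (by linarith) k2
  have good : ∀ᵐ x ∂μ, wd (stab f x) (stab g x) ≠ 0 ∧
      Rate (fun n => ‖fderiv ℝ (f^[n]) x (stab f x)‖) χ2 ∧
      Rate (fun n => ‖fderiv ℝ (f^[n]) x (stab g x)‖) χ1 ∧
      Rate (fun n => ‖fderiv ℝ (g^[n]) x (stab g x)‖) (-χ1) ∧
      Rate (fun n => ‖fderiv ℝ (g^[n]) x (stab f x)‖) (-χ2) ∧
      Tendsto (fun n : ℕ => ‖fderiv ℝ (f^[n]) x (stab f x)‖) atTop (nhds 0) ∧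
      Tendsto (fun n : ℕ => ‖fderiv ℝ (g^[n]) x (stab g x)‖) atTop (nhds 0) ∧
      (∀ w, Tendsto (fun n : ℕ => ‖fderiv ℝ (f^[n]) x w‖) atTop (nhds 0) →
        ∃ c : ℝ, w = c • stab f x) ∧
      (∀ w, Tendsto (fun n : ℕ => ‖fderiv ℝ (g^[n]) x w‖) atTop (nhds 0) →
        ∃ c : ℝ, w = c • stab g x) := by
    filter_upwards [k2, k4, k5, k2', k4', k5', hrec] with x x2 x4 x5 x2' x4' x5' xrec
    have x4a : Rate (fun n => |dt (fderiv ℝ (f^[n]) x)|) (χ1 + χ2) := by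
      convert x4 using 1; rw [hχ2]; ring
    have x4b : Rate (fun n => |dt (fderiv ℝ (g^[n]) x)|) (-(χ1 + χ2)) := by
      convert x4' using 1; rw [hχ2]; ring
    have x4c : Rate (fun n => |dt (fderiv ℝ (g^[n]) x)|) (-χ2 + -χ1) := by
      convert x4' using 1; rw [hχ2]; ring
    have x2b : Rate (fun n => ‖fderiv ℝ (g^[n]) x‖) (-χ2) := by
      convert x2' using 1; rw [b2, hχ2]; ring
    obtain ⟨v, v0, v1, v2⟩ := osel (fun n => fderiv ℝ (f^[n]) x) M χ1 χ2 hM x5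
      (fun n => h.dtne n x) (fun n => h.npos n x) x2 x4a hlt
    obtain ⟨u, u0, u1, u2⟩ := osel (fun n => fderiv ℝ (g^[n]) x) M' (-χ2) (-χ1) hM' x5'
      (fun n => h.symm.dtne n x) (fun n => h.symm.npos n x) x2b x4c (by linarith)
    have hne := not_par f g h x v u χ1 χ2 hlt xrec x4b v0 u0 v1 v2 u1 u2
    obtain ⟨c, c0, ce, ct, cw⟩ := stab_spec f g h x v χ1 χ2 hχ1 hχ2n v0 v1 v2
    obtain ⟨d, d0, de, dtt, dw⟩ := stab_spec g f h.symm x u (-χ2) (-χ1) (by linarith) (by linarith)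
      u0 u1 u2
    have w1 : wd v (stab g x) ≠ 0 := by
      rw [de, wd_swap, wd_smul_left, wd_swap]
      simpa using ⟨d0, hne⟩
    have w2 : wd u (stab f x) ≠ 0 := by
      rw [ce, wd_swap, wd_smul_left]
      simpa using ⟨c0, hne⟩
    refine ⟨?_, ?_, v2 _ w1, ?_, u2 _ w2, ct, dtt, cw, dw⟩
    · rw [ce, wd_smul_left]; exact mul_ne_zero c0 w1
    · rw [ce]; exact v1 c c0
    · rw [de]; exact u1 d d0
  refine ⟨χ2, χ1, ⟨hlt, stab f, stab g, ?_⟩, by linarith, by linarith, by linarith, hχ2n, hχ1⟩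
  filter_upwards [good, herg.toMeasurePreserving.quasiMeasurePreserving.ae good] with x gx gfx
  obtain ⟨g1, g2, g3, g4, g5, g6, g7, g8, g9⟩ := gx
  obtain ⟨-, -, -, -, -, -, -, q8, q9⟩ := gfx
  refine ⟨linind _ _ g1, q8 _ ?_, q9 _ ?_, topZ _ _ _ _ _ g2, botZ _ _ _ _ _ g5,
    topZ _ _ _ _ _ g3, botZ _ _ _ _ _ g4⟩
  · refine ((tendsto_add_atTop_iff_nat 1).2 g6).congr fun n => ?_
    rw [h.chain2]; rfl
  · refine (tendsto_add_atTop_iff_nat 1).1 (g7.congr fun n => ?_)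
    rw [h.symm.chain2, ContinuousLinearMap.comp_apply, h.inv1, h.gf]

end
end

section
/- Let M > 0, a ≥ 3/2, and b > 0 with bM ≤ 1. Let Φ : ℝ² → ℝ² be a continuous map with ‖Φ(z)‖ ≤ M for all z ∈ ℝ², and define f : ℝ² → ℝ² by f(x,y) = (1 − a x², 0) + b·Φ(x,y). If z = (x, y) ∈ ℝ² satisfies |x| ≥ 2, then for every n ≥ 1 the first coordinate of f^n z is at most −2 − 2n; in particular ‖f^n z‖ → ∞ as n → ∞. -/
open Filter

/-- For the Hénon-like map `f(x,y) = (1 − a x², 0) + b Φ(x,y)`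
with `‖Φ‖ ≤ M`, `a ≥ 3/2`, `0 < b`, `bM ≤ 1`, any point `z = (x,y)` with
`|x| ≥ 2` satisfies: the first coordinate of `f^n z` is at most `−2 − 2n` for
every `n ≥ 1`; in particular `‖f^n z‖ → ∞`. -/
theorem stmt8 (M a b : ℝ) (hM : 0 < M) (ha : 3 / 2 ≤ a) (hb : 0 < b)
    (hbM : b * M ≤ 1)
    (Φ : ℝ × ℝ → ℝ × ℝ) (hΦc : Continuous Φ) (hΦ : ∀ z, ‖Φ z‖ ≤ M)
    (f : ℝ × ℝ → ℝ × ℝ)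
    (hf : ∀ x y : ℝ, f (x, y) = (1 - a * x ^ 2, 0) + b • Φ (x, y))
    (x y : ℝ) (hx : 2 ≤ |x|) :
    (∀ n : ℕ, 1 ≤ n → (f^[n] (x, y)).1 ≤ -2 - 2 * n) ∧
      Tendsto (fun n : ℕ => ‖f^[n] (x, y)‖) atTop atTop := by
  have key : ∀ z : ℝ × ℝ, (f z).1 ≤ 2 - 3 / 2 * z.1 ^ 2 := by
    intro z
    have h1 : (f z).1 = 1 - a * z.1 ^ 2 + b * (Φ z).1 := by
      have h := congrArg Prod.fst (hf z.1 z.2)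
      simpa using h
    have h2 : (Φ z).1 ≤ M :=
      (le_abs_self _).trans (((Real.norm_eq_abs _).symm.le.trans (norm_fst_le (Φ z))).trans (hΦ z))
    have h3 : b * (Φ z).1 ≤ b * M := mul_le_mul_of_nonneg_left h2 hb.le
    have h4 : 3 / 2 * z.1 ^ 2 ≤ a * z.1 ^ 2 := mul_le_mul_of_nonneg_right ha (sq_nonneg _)
    linarith
  have main : ∀ n : ℕ, 1 ≤ n → (f^[n] (x, y)).1 ≤ -2 - 2 * n := by
    intro n hn
    induction n, hn using Nat.le_induction with
    | base =>
      have h := key (x, y)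
      have h2 : (4 : ℝ) ≤ x ^ 2 := by
        rw [← sq_abs]; nlinarith
      simp only [Function.iterate_one, Nat.cast_one] at h ⊢
      linarith
    | succ n hn ih =>
      rw [Function.iterate_succ_apply']
      have h := key (f^[n] (x, y))
      have hn' : (1 : ℝ) ≤ n := by exact_mod_cast hn
      push_cast
      nlinarith
  refine ⟨main, ?_⟩
  refine tendsto_atTop_mono' atTop ?_ tendsto_natCast_atTop_atTop
  filter_upwards [eventually_ge_atTop 1] with n hn
  have h1 := main n hn
  have h2 := norm_fst_le (f^[n] (x, y))
  have h3 := neg_le_abs (f^[n] (x, y)).1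
  rw [Real.norm_eq_abs] at h2
  have hn' : (1 : ℝ) ≤ n := by exact_mod_cast hn
  linarith
end

section
/- Let λ > 0, δ ∈ (0,1], C₀ ∈ (0,1], and P ∈ ℕ. Let u : ℕ → ℝ satisfy u_j ≥ log C₀ for every j ∈ ℕ. Let (n_k)_{k≥1} and (p_k)_{k≥1} be sequences of positive integers with n_k + p_k ≤ n_{k+1} and p_k ≤ P for every k ≥ 1. Call an integer n ∈ ℕ free if there is no k with n_k < n < n_k + p_k. Suppose that for every free n one has Σ_{j=0}^{n-1} u_j ≥ log δ + (λ/3)·n. Then for every n ∈ ℕ one has Σ_{j=0}^{n-1} u_j ≥ log δ + P·(log C₀ − λ/4) + (λ/4)·n. -/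
/-- abstract bound/free derivative-growth estimate.  If the
partial sums of `u` grow at rate `λ/3` (with constant `log δ`) at every free
time, where the bound intervals `(n_k, n_k + p_k)` have lengths at most `P`
and during them `u_j ≥ log C₀`, then the partial sums grow at rate `λ/4`
(with constant `log δ + P (log C₀ − λ/4)`) at all times. -/
theorem stmt9 (lam δ C₀ : ℝ) (hlam : 0 < lam) (hδ : 0 < δ) (hδ1 : δ ≤ 1)
    (hC₀ : 0 < C₀) (hC₀1 : C₀ ≤ 1) (P : ℕ)
    (u : ℕ → ℝ) (hu : ∀ j : ℕ, Real.log C₀ ≤ u j)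
    (n p : ℕ → ℕ)
    (hpos : ∀ k, 1 ≤ k → 1 ≤ n k ∧ 1 ≤ p k)
    (hord : ∀ k, 1 ≤ k → n k + p k ≤ n (k + 1))
    (hP : ∀ k, 1 ≤ k → p k ≤ P)
    (hfree : ∀ N : ℕ, (¬ ∃ k, 1 ≤ k ∧ n k < N ∧ N < n k + p k) →
      Real.log δ + (lam / 3) * N ≤ ∑ j ∈ Finset.range N, u j) :
    ∀ N : ℕ,
      Real.log δ + P * (Real.log C₀ - lam / 4) + (lam / 4) * N ≤
        ∑ j ∈ Finset.range N, u j := by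
  have hL : Real.log C₀ ≤ 0 := Real.log_nonpos hC₀.le hC₀1
  have hmono : ∀ a, 1 ≤ a → ∀ b, a ≤ b → n a ≤ n b := by
    intro a ha b hab
    induction b, hab using Nat.le_induction with
    | base => exact le_rfl
    | succ b hb ih =>
      have := hord b (by omega)
      omega
  intro N
  have hN0 : (0 : ℝ) ≤ N := Nat.cast_nonneg N
  have hP0 : (0 : ℝ) ≤ P := Nat.cast_nonneg P
  by_cases hN : ∃ k, 1 ≤ k ∧ n k < N ∧ N < n k + p k
  · obtain ⟨k, hk, h1, h2⟩ := hN
    have hf := hfree (n k) (by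
      rintro ⟨l, hl, h3, h4⟩
      rcases lt_or_ge l k with h | h
      · have := hord l hl
        have := hmono (l + 1) (by omega) k h
        omega
      · have := hmono k hk l h
        omega)
    obtain ⟨d, rfl⟩ : ∃ d, N = n k + d := ⟨N - n k, by omega⟩
    have hd : d ≤ P := by
      have := hP k hk
      omega
    have hd' : (d : ℝ) ≤ P := by exact_mod_cast hd
    have hs : (d : ℝ) * Real.log C₀ ≤ ∑ j ∈ Finset.range d, u (n k + j) := by
      have := Finset.card_nsmul_le_sum (Finset.range d) (fun j => u (n k + j))
        (Real.log C₀) (fun j _ => hu _)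
      simpa using this
    rw [Finset.sum_range_add]
    push_cast
    have hm : (0 : ℝ) ≤ n k := Nat.cast_nonneg _
    have e1 := mul_nonneg hlam.le hm
    have e2 := mul_le_mul_of_nonneg_left hd' hlam.le
    have e3 := mul_le_mul_of_nonpos_right hd' hL
    linarith
  · have hf := hfree N hN
    have e1 := mul_nonneg hlam.le hN0
    have e2 := mul_nonneg hlam.le hP0
    have e3 := mul_nonpos_of_nonneg_of_nonpos hP0 hL
    linarith
end

section
/- Let g : ℝ → ℝ be the Chebyshev quadratic map g(x) = 1 − 2x², and set λ̂ = (99/100)·log 2. There exists δ₀ ∈ (0,1) such that for every δ ∈ (0, δ₀), every integer n ≥ 1, and every x ∈ [−1,1]: if |g^j(x)| ≥ δ for all 0 ≤ j ≤ n−1, then |(g^n)'(x)| ≥ δ·e^{λ̂ n}; if moreover |g^n(x)| < δ, then |(g^n)'(x)| ≥ e^{λ̂ n}. -/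
theorem aux_deriv (n : ℕ) (x : ℝ) :
    HasDerivAt ((fun y : ℝ => 1 - 2 * y ^ 2)^[n]) (deriv ((fun y : ℝ => 1 - 2 * y ^ 2)^[n]) x) x := by
  have h : Differentiable ℝ (fun y : ℝ => 1 - 2 * y ^ 2) := by fun_prop
  exact ((h.iterate n) x).hasDerivAt

theorem aux_succ (n : ℕ) (x : ℝ) :
    deriv ((fun y : ℝ => 1 - 2 * y ^ 2)^[n+1]) x =
      (-4 * (fun y : ℝ => 1 - 2 * y ^ 2)^[n] x) * deriv ((fun y : ℝ => 1 - 2 * y ^ 2)^[n]) x := by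
  rw [Function.iterate_succ']
  have h : ∀ z : ℝ, HasDerivAt (fun y : ℝ => 1 - 2 * y ^ 2) (-4 * z) z := by
    intro z
    have := (((hasDerivAt_id z).pow 2).const_mul 2).const_sub 1
    refine this.congr_deriv ?_
    simp only [id]; norm_num; ring
  exact ((h _).comp x (aux_deriv n x)).deriv

theorem aux_id (n : ℕ) (x : ℝ) :
    (1 - x ^ 2) * (deriv ((fun y : ℝ => 1 - 2 * y ^ 2)^[n]) x) ^ 2 =
      4 ^ n * (1 - ((fun y : ℝ => 1 - 2 * y ^ 2)^[n] x) ^ 2) := by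
  induction n with
  | zero => simp
  | succ n ih =>
    rw [aux_succ, Function.iterate_succ_apply']
    linear_combination (16 * ((fun y : ℝ => 1 - 2 * y ^ 2)^[n] x) ^ 2) * ih

theorem aux_low (n : ℕ) (x : ℝ) :
    4 ^ n * (1 - ((fun y : ℝ => 1 - 2 * y ^ 2)^[n] x) ^ 2) ≤
      (deriv ((fun y : ℝ => 1 - 2 * y ^ 2)^[n]) x) ^ 2 := by
  rw [← aux_id]
  nlinarith [mul_nonneg (sq_nonneg x) (sq_nonneg (deriv ((fun y : ℝ => 1 - 2 * y ^ 2)^[n]) x))]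

theorem aux_first (δ : ℝ) (h0 : 0 < δ) (h1 : δ < 1) (x : ℝ) (n : ℕ)
    (h : ∀ j < n, δ ≤ |(fun y : ℝ => 1 - 2 * y ^ 2)^[j] x|) :
    δ * 2 ^ n ≤ |deriv ((fun y : ℝ => 1 - 2 * y ^ 2)^[n]) x| := by
  induction n with
  | zero => simpa using h1.le
  | succ n ih =>
    have ih' := ih (fun j hj => h j (by omega))
    have hn := h n (by omega)
    have hl := aux_low n x
    rw [aux_succ, abs_mul, abs_mul]
    rw [← sq_abs, ← sq_abs (deriv _ x)] at hl
    have h4 : |(-4 : ℝ)| = 4 := by norm_num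
    rw [h4]
    have hd := abs_nonneg (deriv ((fun y : ℝ => 1 - 2 * y ^ 2)^[n]) x)
    generalize |deriv ((fun y : ℝ => 1 - 2 * y ^ 2)^[n]) x| = d at *
    generalize |(fun y : ℝ => 1 - 2 * y ^ 2)^[n] x| = t at *
    have hp : (0 : ℝ) < 2 ^ n := by positivity
    have e4 : (4 : ℝ) ^ n = (2 ^ n) ^ 2 := by rw [← pow_mul, mul_comm, pow_mul]; norm_num
    rw [e4] at hl
    rw [pow_succ]
    generalize (2 : ℝ) ^ n = p at *
    by_cases ht : 1 / 2 ≤ t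
    · nlinarith
    · push Not at ht
      have hdp : p / 2 ≤ d := by
        refine abs_le_of_sq_le_sq' ?_ hd |>.2
        have : t ^ 2 ≤ 1 / 4 := by nlinarith
        nlinarith [sq_nonneg p]
      nlinarith [mul_le_mul hn hdp (by positivity) (by linarith)]


/-- expansion estimate for the Chebyshev quadratic map
`g(x) = 1 − 2x²` outside the critical region `(−δ, δ)`, with
`λ̂ = (99/100) log 2`: there exists `δ₀ ∈ (0,1)` such that for every
`δ ∈ (0, δ₀)`, every `n ≥ 1` and every `x ∈ [−1,1]` whose orbit avoids
`(−δ, δ)` up to time `n−1`, one has `|(gⁿ)'(x)| ≥ δ e^{λ̂ n}`, and moreover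
`|(gⁿ)'(x)| ≥ e^{λ̂ n}` if additionally `|gⁿ(x)| < δ`. -/
theorem stmt10 :
    ∃ δ₀ : ℝ, 0 < δ₀ ∧ δ₀ < 1 ∧
      ∀ δ ∈ Set.Ioo (0 : ℝ) δ₀, ∀ n : ℕ, 1 ≤ n →
        ∀ x ∈ Set.Icc (-1 : ℝ) 1,
          (∀ j < n, δ ≤ |(fun y : ℝ => 1 - 2 * y ^ 2)^[j] x|) →
            δ * Real.exp ((99 / 100 * Real.log 2) * n) ≤
              |deriv ((fun y : ℝ => 1 - 2 * y ^ 2)^[n]) x| ∧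
            (|(fun y : ℝ => 1 - 2 * y ^ 2)^[n] x| < δ →
              Real.exp ((99 / 100 * Real.log 2) * n) ≤
                |deriv ((fun y : ℝ => 1 - 2 * y ^ 2)^[n]) x|) := by
  refine ⟨1 / 10, by norm_num, by norm_num, ?_⟩
  intro δ hδ n hn x _ h
  obtain ⟨h0, h1⟩ := hδ
  have hlog := Real.log_two_gt_d9
  have hn' : (1 : ℝ) ≤ n := by exact_mod_cast hn
  have key : Real.exp ((99 / 100 * Real.log 2) * n) * 1.006 ≤ 2 ^ n := by
    have e2 : (2 : ℝ) ^ n = Real.exp ((99 / 100 * Real.log 2) * n) *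
        Real.exp (Real.log 2 / 100 * n) := by
      rw [← Real.exp_add, ← Real.exp_log (show (0 : ℝ) < 2 by norm_num), ← Real.exp_nat_mul,
        Real.exp_log (by norm_num)]
      congr 1; ring
    rw [e2]
    apply mul_le_mul_of_nonneg_left _ (Real.exp_pos _).le
    have := Real.add_one_le_exp (Real.log 2 / 100 * n)
    nlinarith
  have he := Real.exp_pos ((99 / 100 * Real.log 2) * n)
  generalize Real.exp ((99 / 100 * Real.log 2) * n) = e at *
  constructor
  · refine le_trans ?_ (aux_first δ h0 (by linarith) x n h)
    apply mul_le_mul_of_nonneg_left _ h0.le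
    linarith
  · intro ht
    have hl := aux_low n x
    rw [← sq_abs, ← sq_abs (deriv _ x)] at hl
    refine abs_le_of_sq_le_sq' ?_ (abs_nonneg _) |>.2
    refine le_trans ?_ hl
    have h2 : |(fun y : ℝ => 1 - 2 * y ^ 2)^[n] x| ^ 2 ≤ 1 / 100 := by
      nlinarith [abs_nonneg ((fun y : ℝ => 1 - 2 * y ^ 2)^[n] x)]
    have e4 : (4 : ℝ) ^ n = (2 ^ n) ^ 2 := by rw [← pow_mul, mul_comm, pow_mul]; norm_num
    rw [e4]
    have h3 : (e * 1.006) ^ 2 ≤ ((2 : ℝ) ^ n) ^ 2 := by gcongr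
    nlinarith [sq_nonneg ((2 : ℝ) ^ n), sq_nonneg e]
end

section
/- Let 0 < λ ≤ λ̂ and δ ∈ (0,1]. Let (w_n)_{n≥1} be a sequence of positive real numbers and let 0 < n₁ < n₁ + p₁ ≤ n₂ < n₂ + p₂ ≤ ⋯ be integers with p_i ≥ 1, satisfying: (i) w_n ≥ δ·e^{λ̂(n-1)} for every 1 ≤ n ≤ n₁, and w_{n₁} ≥ e^{λ̂(n₁-1)}; (ii) w_{n_i + p_i} ≥ e^{(λ/3) p_i}·w_{n_i} for every i ≥ 1; (iii) w_n ≥ δ·e^{λ̂(n − n_i − p_i)}·w_{n_i + p_i} for every i ≥ 1 and every n with n_i + p_i ≤ n ≤ n_{i+1}, and w_{n_{i+1}} ≥ e^{λ̂(n_{i+1} − n_i − p_i)}·w_{n_i + p_i}. Then w_{n_i} ≥ e^{(λ/3)(n_i - 1)} for every i ≥ 1, and w_n ≥ δ·e^{(λ/3)(n-1)} for every n not lying in any interval (n_i, n_i + p_i). -/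
/-- abstract bound/free derivative-growth lemma.  `w_n` plays
the role of the derivative norm at time `n`, the times `n_i` are the returns
to the critical region, the intervals `(n_i, n_i + p_i)` are the bound
periods during which the derivative recovers by the factor `e^{(λ/3) p_i}`,
and the orbit expands at rate `λ̂` during free periods; the conclusion is
growth at rate `λ/3` at all free times. -/
theorem stmt12 (lam lamhat δ : ℝ) (hlam : 0 < lam) (hlamhat : lam ≤ lamhat)
    (hδ : 0 < δ) (hδ1 : δ ≤ 1)
    (w : ℕ → ℝ) (hw : ∀ k : ℕ, 1 ≤ k → 0 < w k)
    (n p : ℕ → ℕ)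
    (hn1 : 0 < n 1) (hp : ∀ i, 1 ≤ i → 1 ≤ p i)
    (hord : ∀ i, 1 ≤ i → n i + p i ≤ n (i + 1))
    (hi : ∀ k : ℕ, 1 ≤ k → k ≤ n 1 →
      δ * Real.exp (lamhat * ((k : ℝ) - 1)) ≤ w k)
    (hi' : Real.exp (lamhat * ((n 1 : ℝ) - 1)) ≤ w (n 1))
    (hii : ∀ i, 1 ≤ i →
      Real.exp ((lam / 3) * (p i : ℝ)) * w (n i) ≤ w (n i + p i))
    (hiii : ∀ i, 1 ≤ i → ∀ k : ℕ, n i + p i ≤ k → k ≤ n (i + 1) →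
      δ * Real.exp (lamhat * ((k : ℝ) - (n i : ℝ) - (p i : ℝ))) * w (n i + p i) ≤ w k)
    (hiii' : ∀ i, 1 ≤ i →
      Real.exp (lamhat * ((n (i + 1) : ℝ) - (n i : ℝ) - (p i : ℝ))) * w (n i + p i) ≤
        w (n (i + 1))) :
    (∀ i, 1 ≤ i → Real.exp ((lam / 3) * ((n i : ℝ) - 1)) ≤ w (n i)) ∧
      (∀ k : ℕ, 1 ≤ k → (¬ ∃ i, 1 ≤ i ∧ n i < k ∧ k < n i + p i) →
        δ * Real.exp ((lam / 3) * ((k : ℝ) - 1)) ≤ w k) := by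
  have key : ∀ a : ℝ, 0 ≤ a → Real.exp (lam / 3 * a) ≤ Real.exp (lamhat * a) := by
    intro a ha
    apply Real.exp_le_exp.mpr
    apply mul_le_mul_of_nonneg_right _ ha
    linarith
  have bnd : ∀ i, 1 ≤ i → Real.exp ((lam / 3) * ((n i : ℝ) - 1)) ≤ w (n i) →
      Real.exp ((lam / 3) * ((n i : ℝ) + p i - 1)) ≤ w (n i + p i) := by
    intro i h1 h
    refine le_trans ?_ (hii i h1)
    refine le_trans (le_of_eq ?_) (mul_le_mul_of_nonneg_left h (Real.exp_pos _).le)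
    rw [← Real.exp_add]
    congr 1
    ring
  have step : ∀ i, 1 ≤ i → Real.exp ((lam / 3) * ((n i : ℝ) - 1)) ≤ w (n i) →
      ∀ k : ℕ, n i + p i ≤ k → Real.exp ((lam / 3) * ((k : ℝ) - 1)) ≤
        Real.exp (lamhat * ((k : ℝ) - (n i : ℝ) - (p i : ℝ))) * w (n i + p i) := by
    intro i h1 h k hk
    have hk' : (n i : ℝ) + p i ≤ k := by exact_mod_cast hk
    refine le_trans (le_of_eq ?_) (mul_le_mul (key ((k : ℝ) - n i - p i) (by linarith))
      (bnd i h1 h) (Real.exp_pos _).le (Real.exp_pos _).le)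
    rw [← Real.exp_add]
    congr 1
    ring
  have A : ∀ i, 1 ≤ i → Real.exp ((lam / 3) * ((n i : ℝ) - 1)) ≤ w (n i) := by
    intro i h1
    induction i, h1 using Nat.le_induction with
    | base =>
      have : (1 : ℝ) ≤ n 1 := by exact_mod_cast hn1
      exact (key _ (by linarith)).trans hi'
    | succ i h1 ih => exact (step i h1 ih _ (hord i h1)).trans (hiii' i h1)
  refine ⟨A, ?_⟩
  intro k hk hfree
  have ge : ∀ i, 1 ≤ i → i ≤ n i := by
    intro i h1
    induction i, h1 using Nat.le_induction with
    | base => exact hn1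
    | succ i h1 ih =>
      have := hord i h1
      have := hp i h1
      omega
  have loc : ∀ m, 1 ≤ m → k ≤ n m → k ≤ n 1 ∨ ∃ i, 1 ≤ i ∧ n i < k ∧ k ≤ n (i + 1) := by
    intro m h1
    induction m, h1 using Nat.le_induction with
    | base => exact Or.inl
    | succ m h1 ih =>
      intro h
      rcases le_or_gt k (n m) with h2 | h2
      · exact ih h2
      · exact Or.inr ⟨m, h1, h2, h⟩
  rcases loc k hk (ge k hk) with h | ⟨i, h1, h2, h3⟩
  · have : (1 : ℝ) ≤ k := by exact_mod_cast hk
    exact (mul_le_mul_of_nonneg_left (key _ (by linarith)) hδ.le).trans (hi k hk h)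
  · have h4 : n i + p i ≤ k := by
      by_contra h5
      exact hfree ⟨i, h1, h2, by omega⟩
    have := mul_le_mul_of_nonneg_left (step i h1 (A i h1) k h4) hδ.le
    rw [← mul_assoc] at this
    exact this.trans (hiii i h1 k h4 h3)
end
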